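/- arXiv:1903.04867 — 3 statements merged into one kernel-verified Lean document; each statement's English description precedes it below -/
import Mathlib

section
/- Let T be a tree and ω a nonnegative weight function on V(T) with nonempty support W. Then the ω-cover pebbling number of T equals γ_ω(T) = max over v ∈ V(T) of [ Σ_{u ∈ W} ω(u)·2^{d(u,v)} + Σ_{i=1}^n (2^{a_i} − 1) ], where T_ω(v) is the minimal subtree of T containing v and all vertices of W, and (a_1, ..., a_n) are the path lengths of the maximum path partition of T with the edges of T_ω(v) removed and all remaining edges directed toward T_ω(v). -/
open SimpleGraph Finset

variable {V : Type*} [DecidableEq V]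

/-- A single pebbling move: remove two pebbles from `u` and add one on an adjacent `v`. -/
def PebStep (G : SimpleGraph V) (D D' : V → ℕ) : Prop :=
  ∃ u v, G.Adj u v ∧ 2 ≤ D u ∧
    D' = fun x => if x = u then D u - 2 else if x = v then D v + 1 else D x

/-- Reachability by a sequence of pebbling moves. -/
def PebReach (G : SimpleGraph V) : (V → ℕ) → (V → ℕ) → Prop :=
  Relation.ReflTransGen (PebStep G)

/-- `D` is `ω`-solvable: some sequence of pebbling moves reaches `D'` with `D' ≥ ω`. -/
def Solvable (G : SimpleGraph V) (ω D : V → ℕ) : Prop :=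
  ∃ D', PebReach G D D' ∧ ∀ v, ω v ≤ D' v

/-- The `ω`-cover pebbling number: least `N` such that every distribution of
`N` pebbles is `ω`-solvable. -/
noncomputable def coverNum [Fintype V] (G : SimpleGraph V) (ω : V → ℕ) : ℕ :=
  sInf {N | ∀ D : V → ℕ, (∑ v, D v) = N → Solvable G ω D}

/-- The `t`-pebbling number of a vertex `v`: least `N` such that from every
distribution of `N` pebbles one can move `t` pebbles onto `v`. -/
noncomputable def ftNum [Fintype V] (G : SimpleGraph V) (v : V) (t : ℕ) : ℕ :=
  sInf {N | ∀ D : V → ℕ, (∑ x, D x) = N → ∃ D', PebReach G D D' ∧ t ≤ D' v}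
/-- A system of (directed) paths in `G`, each recorded as a walk with its endpoints. -/
abbrev PathSys (G : SimpleGraph V) := List (Σ a : V, Σ b : V, G.Walk a b)

/-- The list of lengths of the paths in the system. -/
def sysLengths {G : SimpleGraph V} (P : PathSys G) : List ℕ := P.map fun q => q.2.2.length

/-- `P` is a path partition of the directed graph whose edges are the edges of `G`
oriented so that the potential `φ` strictly decreases (for trees, `φ` is the distance
to the root or to the target subtree): the paths are directed (each dart decreases `φ`),
nontrivial, pairwise edge-disjoint, and together cover every directable edge. -/
def IsPartitionTo (G : SimpleGraph V) (φ : V → ℕ) (P : PathSys G) : Prop :=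
  (∀ q ∈ P, q.2.2.IsPath ∧ 0 < q.2.2.length ∧ ∀ d ∈ q.2.2.darts, φ d.snd < φ d.fst) ∧
  P.Pairwise (fun q r => ∀ e ∈ q.2.2.edges, e ∉ r.2.2.edges) ∧
  ∀ a b : V, G.Adj a b → φ b < φ a → ∃ q ∈ P, s(a, b) ∈ q.2.2.edges

/-- Sort a list of naturals in nonincreasing order. -/
def sortDesc (l : List ℕ) : List ℕ := l.insertionSort (· ≥ ·)

/-- `P` is a maximum path partition: its nonincreasing length sequence
lexicographically majorizes that of every other path partition. -/
def IsMaxPartitionTo (G : SimpleGraph V) (φ : V → ℕ) (P : PathSys G) : Prop :=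
  IsPartitionTo G φ P ∧ ∀ Q : PathSys G, IsPartitionTo G φ Q →
    ¬ List.Lex (· < ·) (sortDesc (sysLengths P)) (sortDesc (sysLengths Q))

/-- `∑ᵢ (2^{aᵢ} - 1)` over the path lengths of the system. -/
def pathsExtra {G : SimpleGraph V} (P : PathSys G) : ℕ :=
  ((sysLengths P).map fun a => 2 ^ a - 1).sum

/-- Vertices of the minimal subtree spanning `S`: vertices lying on a geodesic
between two members of `S`. -/
def subtreeSpan (G : SimpleGraph V) (S : Set V) : Set V :=
  {u | ∃ x ∈ S, ∃ y ∈ S, G.dist x u + G.dist u y = G.dist x y}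

/-- Distance from a vertex to a set. -/
noncomputable def distToSet (G : SimpleGraph V) (A : Set V) (u : V) : ℕ :=
  sInf {n | ∃ w ∈ A, G.dist u w = n}

/-- The potential used for `s_ω(v)`: the distance to the minimal subtree `T_ω(v)`
containing `v` and the support of `ω`. -/
noncomputable def phiOmega (G : SimpleGraph V) (ω : V → ℕ) (v : V) : V → ℕ :=
  distToSet G (subtreeSpan G (insert v {u | 0 < ω u}))

set_option linter.unusedSectionVars false

namespace SimpleGraph.IsTree

variable {T : SimpleGraph V} (hT : T.IsTree)
include hT

lemma closer_unique {x u c p : V} (hc : T.Adj u c) (hp : T.Adj u p)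
    (hxc : T.dist x c < T.dist x u) (hxp : T.dist x p < T.dist x u) : c = p := by
  have key : ∀ {c : V}, T.Adj u c → T.dist x c < T.dist x u →
      ∃ q : T.Walk x u, q.IsPath ∧ q.penultimate = c := by
    intro c hc hxc
    obtain ⟨w, hw⟩ := hT.connected.exists_walk_length_eq_dist x c
    refine ⟨w.concat hc.symm, Walk.isPath_of_length_eq_dist _ ?_, by simp⟩
    have := hT.dist_eq_dist_add_one_of_adj x hc
    rw [Walk.length_concat]
    omega
  obtain ⟨q, hq, rfl⟩ := key hc hxc
  obtain ⟨r, hr, rfl⟩ := key hp hxp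
  rw [(hT.existsUnique_path x u).unique hq hr]

lemma exists_closer {x u : V} (h : u ≠ x) : ∃ p, T.Adj u p ∧ T.dist x p + 1 = T.dist x u := by
  obtain ⟨w, hw⟩ := hT.connected.exists_walk_length_eq_dist u x
  cases w with
  | nil => exact absurd rfl h
  | @cons _ p _ hp q =>
    refine ⟨p, hp, ?_⟩
    have h1 := hT.dist_eq_dist_add_one_of_adj x hp
    have h2 := T.dist_le q
    rw [Walk.length_cons] at hw
    rw [dist_comm (u := x) (v := u), dist_comm (u := x) (v := p)] at *
    omega

lemma dist_eq_add_of_dist_lt {v x u p : V} (hp : T.Adj u p) (hv : T.dist v p < T.dist v u)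
    (hx : T.dist x u < T.dist x p) : T.dist v x = T.dist v u + T.dist u x := by
  induction h : T.dist x u generalizing u p with
  | zero =>
    rw [hT.connected.dist_eq_zero_iff] at h
    subst h
    simp
  | succ n ih =>
    have hne : u ≠ x := by rintro rfl; simp at h
    obtain ⟨c, hc, hcx⟩ := hT.exists_closer hne
    have hcv : T.dist v u < T.dist v c := by
      have := hT.dist_eq_dist_add_one_of_adj v hc
      by_contra hlt
      have := hT.closer_unique hc hp (x := v) (by omega) hv
      subst this
      omega
    have h1 := ih hc.symm hcv (by omega) (by omega)
    have h2 := hT.dist_eq_dist_add_one_of_adj v hc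
    rw [dist_comm (u := c)] at h1
    rw [dist_comm (u := u)]
    omega

lemma dist_lt_of_dist_eq_add {v x u p : V} (hv : T.dist v p < T.dist v u)
    (h : T.dist v x = T.dist v u + T.dist u x) : T.dist x u < T.dist x p := by
  have h1 := hT.connected.dist_triangle (u := v) (v := p) (w := x)
  rw [dist_comm (u := x), dist_comm (u := x)]
  omega

lemma mem_subtreeSpan_insert_iff {v : V} {W : Set V} {u : V} :
    u ∈ subtreeSpan T (insert v W) ↔
      ∃ w ∈ insert v W, T.dist v w = T.dist v u + T.dist u w := by
  constructor
  · rintro ⟨x, hx, y, hy, hxy⟩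
    by_cases huv : u = v
    · exact ⟨v, by simp, by simp [huv]⟩
    obtain ⟨p, hp, hpv⟩ := hT.exists_closer huv
    have hx' := hT.dist_eq_dist_add_one_of_adj x hp
    have hy' := hT.dist_eq_dist_add_one_of_adj y hp
    have h1 := hT.connected.dist_triangle (u := x) (v := p) (w := y)
    rw [dist_comm (u := u) (v := y)] at hxy
    rw [dist_comm (u := p) (v := y)] at h1
    rcases lt_or_ge (T.dist x u) (T.dist x p) with h | h
    · exact ⟨x, hx, hT.dist_eq_add_of_dist_lt hp (by omega) h⟩
    · exact ⟨y, hy, hT.dist_eq_add_of_dist_lt hp (by omega) (by omega)⟩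
  · rintro ⟨w, hw, h⟩
    exact ⟨v, by simp, w, hw, h.symm⟩

lemma mem_subtreeSpan_of_dist_lt {v : V} {W : Set V} {a b : V} (hab : T.Adj a b)
    (hv : T.dist v b < T.dist v a) (ha : a ∈ subtreeSpan T (insert v W)) :
    b ∈ subtreeSpan T (insert v W) := by
  rw [hT.mem_subtreeSpan_insert_iff] at ha ⊢
  obtain ⟨w, hw, h⟩ := ha
  refine ⟨w, hw, ?_⟩
  have h1 := hT.dist_eq_dist_add_one_of_adj v hab
  have h2 := hT.dist_lt_of_dist_eq_add hv h
  have h3 := hT.dist_eq_dist_add_one_of_adj w hab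
  rw [dist_comm (u := a) (v := w)] at h
  rw [dist_comm (u := b) (v := w)]
  omega

lemma distToSet_lt_iff {v : V} {W : Set V} {a b : V} (hab : T.Adj a b) :
    distToSet T (subtreeSpan T (insert v W)) b < distToSet T (subtreeSpan T (insert v W)) a ↔
      a ∉ subtreeSpan T (insert v W) ∧ T.dist v b < T.dist v a := by
  set C := subtreeSpan T (insert v W) with hC
  have hvC : v ∈ C := hT.mem_subtreeSpan_insert_iff.2 ⟨v, by simp, by simp⟩
  have hzero : ∀ x ∈ C, distToSet T C x = 0 := fun x hx =>
    Nat.eq_zero_of_le_zero (Nat.sInf_le ⟨x, hx, by simp⟩)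
  have hdesc : ∀ {a b : V}, T.Adj a b → a ∉ C → T.dist v b < T.dist v a →
      distToSet T C b < distToSet T C a := by
    intro a b hab ha hv
    obtain ⟨w, hw, h⟩ : distToSet T C a ∈ {n | ∃ w ∈ C, T.dist a w = n} :=
      Nat.sInf_mem ⟨_, v, hvC, rfl⟩
    have h1 : distToSet T C b ≤ T.dist b w := Nat.sInf_le ⟨w, hw, rfl⟩
    have h3 := hT.dist_eq_dist_add_one_of_adj w hab
    rw [dist_comm (u := a) (v := w)] at h
    rw [dist_comm (u := b) (v := w)] at h1
    by_contra hlt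
    have h4 := hT.dist_eq_add_of_dist_lt hab hv (x := w) (by omega)
    obtain ⟨w', hw', h'⟩ := hT.mem_subtreeSpan_insert_iff.1 hw
    refine ha (hT.mem_subtreeSpan_insert_iff.2 ⟨w', hw', ?_⟩)
    have h5 := hT.connected.dist_triangle (u := a) (v := w) (w := w')
    have h6 := hT.connected.dist_triangle (u := v) (v := a) (w := w')
    omega
  constructor
  · intro h
    have ha : a ∉ C := fun ha => by rw [hzero a ha] at h; omega
    refine ⟨ha, ?_⟩
    by_contra hlt
    have hba : T.dist v a < T.dist v b := by
      have := hT.dist_eq_dist_add_one_of_adj v hab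
      omega
    have hb : b ∉ C := fun hb => ha (hT.mem_subtreeSpan_of_dist_lt hab.symm hba hb)
    exact absurd (hdesc hab.symm hb hba) (by omega)
  · rintro ⟨ha, hv⟩
    exact hdesc hab ha hv

end SimpleGraph.IsTree

/-- The number of pebbles that an excess of `x` pebbles (a deficit, if `x < 0`) at a vertex
contributes to a neighbour. -/
def pebTransfer (x : ℤ) : ℤ := if x < 0 then 2 * x else x / 2

lemma pebTransfer_add_one_le (x : ℤ) : pebTransfer (x + 1) ≤ pebTransfer x + 2 := by
  unfold pebTransfer
  grind

lemma pebTransfer_sub_two_le (x : ℤ) : pebTransfer (x - 2) ≤ pebTransfer x - 1 := by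
  unfold pebTransfer
  grind

lemma pebTransfer_nonneg {x : ℤ} (h : 0 ≤ x) : 0 ≤ pebTransfer x := by
  unfold pebTransfer
  grind

open Classical in
/-- The neighbours of `u` that are further from `r` than `u`. -/
noncomputable def rootedChildren [Fintype V] (T : SimpleGraph V) (r u : V) : Finset V :=
  univ.filter fun c => T.Adj u c ∧ T.dist r u < T.dist r c

lemma mem_rootedChildren [Fintype V] {T : SimpleGraph V} {r u c : V} :
    c ∈ rootedChildren T r u ↔ T.Adj u c ∧ T.dist r u < T.dist r c := by
  simp [rootedChildren]

lemma rootedChildren_induction [Fintype V] (T : SimpleGraph V) (r : V) {p : V → Prop}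
    (h : ∀ u, (∀ c ∈ rootedChildren T r u, p c) → p u) (u : V) : p u := by
  induction hn : univ.sup (T.dist r) - T.dist r u using Nat.strong_induction_on generalizing u with
  | _ n ih =>
    refine h u fun c hc => ?_
    rw [mem_rootedChildren] at hc
    have : T.dist r c ≤ univ.sup (T.dist r) := le_sup (f := T.dist r) (mem_univ c)
    exact ih _ (by omega) c rfl

lemma sum_pebTransfer_update (s : Finset V) (f : V → ℤ) (b : V) (y : ℤ) :
    ∑ c ∈ s, pebTransfer (Function.update f b y c) =
      ∑ c ∈ s, pebTransfer (f c) + if b ∈ s then pebTransfer y - pebTransfer (f b) else 0 := by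
  split_ifs with hb
  · rw [← add_sum_erase _ _ hb, ← add_sum_erase _ _ hb, Function.update_self]
    have : ∀ c ∈ s.erase b, pebTransfer (Function.update f b y c) = pebTransfer (f c) := by
      intro c hc
      rw [Function.update_of_ne (ne_of_mem_erase hc)]
    rw [sum_congr rfl this]
    ring
  · rw [add_zero]
    refine sum_congr rfl fun c hc => ?_
    rw [Function.update_of_ne]
    rintro rfl
    exact hb hc

namespace SimpleGraph.IsTree

variable [Fintype V] {T : SimpleGraph V} (hT : T.IsTree)
include hT

lemma mem_rootedChildren_or {a b : V} (r : V) (hab : T.Adj a b) :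
    b ∈ rootedChildren T r a ∨ a ∈ rootedChildren T r b := by
  rw [mem_rootedChildren, mem_rootedChildren]
  have := hT.dist_eq_dist_add_one_of_adj r hab
  rcases this with h | h
  · exact Or.inr ⟨hab.symm, by omega⟩
  · exact Or.inl ⟨hab, by omega⟩

lemma eq_of_mem_rootedChildren {r a b c : V} (ha : c ∈ rootedChildren T r a)
    (hb : c ∈ rootedChildren T r b) : a = b := by
  rw [mem_rootedChildren] at ha hb
  exact hT.closer_unique ha.1.symm hb.1.symm ha.2 hb.2

lemma exists_mem_rootedChildren {r c : V} (hc : c ≠ r) : ∃ p, c ∈ rootedChildren T r p := by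
  obtain ⟨p, hp, h⟩ := hT.exists_closer hc
  exact ⟨p, mem_rootedChildren.2 ⟨hp.symm, by omega⟩⟩

lemma not_solvable_of_excess_le {ω D : V → ℕ} (r : V) (f : V → ℤ)
    (hf : ∀ u, (D u : ℤ) - ω u + ∑ c ∈ rootedChildren T r u, pebTransfer (f c) ≤ f u)
    (hr : f r < 0) : ¬ Solvable T ω D := by
  rintro ⟨D', hD', hω⟩
  have key : ∃ f : V → ℤ, (∀ u, (D' u : ℤ) - ω u +
      ∑ c ∈ rootedChildren T r u, pebTransfer (f c) ≤ f u) ∧ f r < 0 := by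
    clear hω
    induction hD' with
    | refl => exact ⟨f, hf, hr⟩
    | @tail D₁ D₂ _ hstep ih =>
      obtain ⟨f, hf, hr⟩ := ih
      obtain ⟨a, b, hab, h2, rfl⟩ := hstep
      have hne := hab.ne
      rcases hT.mem_rootedChildren_or r hab with hb | ha
      · refine ⟨Function.update f b (f b + 1), fun u => ?_, ?_⟩
        · have h1 := hf u
          have h3 := pebTransfer_add_one_le (f b)
          have h4 : b ∈ rootedChildren T r u → u = a := fun h =>
            hT.eq_of_mem_rootedChildren h hb
          rw [sum_pebTransfer_update]
          beta_reduce
          by_cases hua : u = a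
          · subst hua
            rw [Function.update_of_ne hne]
            simp only [if_pos, hb]
            push_cast [h2]
            omega
          · rw [if_neg hua, if_neg (fun h => hua (h4 h))]
            by_cases hub : u = b
            · subst hub
              simp only [if_true, Function.update_self]
              push_cast
              omega
            · rw [if_neg hub, Function.update_of_ne hub]
              omega
        · rw [Function.update_of_ne]
          · exact hr
          · rintro rfl
            rw [mem_rootedChildren] at hb
            simp at hb
      · refine ⟨Function.update f a (f a - 2), fun u => ?_, ?_⟩
        · have h1 := hf u
          have h3 := pebTransfer_sub_two_le (f a)
          have h4 : a ∈ rootedChildren T r u → u = b := fun h =>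
            hT.eq_of_mem_rootedChildren h ha
          rw [sum_pebTransfer_update]
          beta_reduce
          by_cases hub : u = b
          · subst hub
            rw [Function.update_of_ne hne.symm, if_neg hne.symm]
            simp only [if_pos, ha]
            push_cast
            omega
          · rw [if_neg (fun h => hub (h4 h))]
            by_cases hua : u = a
            · subst hua
              simp only [if_true, Function.update_self]
              push_cast [h2]
              omega
            · rw [if_neg hub, if_neg hua, Function.update_of_ne hua]
              omega
        · by_cases h : r = a
          · subst h
            simp only [Function.update_self]
            omega
          · rwa [Function.update_of_ne h]
  obtain ⟨f, hf, hr⟩ := key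
  have hnn : ∀ u, 0 ≤ f u := rootedChildren_induction T r fun u ih => by
    have h1 := sum_nonneg fun c hc => pebTransfer_nonneg (ih c hc)
    have h2 := hf u
    have h3 := hω u
    omega
  exact absurd (hnn r) (by omega)

open Classical in
lemma card_filter_dist_lt {x y z : V} (hxy : T.Adj x y) (hzx : T.Adj z x) (hzy : z ≠ y) :
    #{t | T.dist t z < T.dist t x} < #{t | T.dist t x < T.dist t y} := by
  refine card_lt_card ⟨fun t ht => ?_, fun h => ?_⟩
  · simp only [mem_filter, mem_univ, true_and] at ht ⊢
    by_contra hlt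
    have := hT.dist_eq_dist_add_one_of_adj t hxy
    exact hzy (hT.closer_unique hzx.symm hxy ht (by omega))
  · have : x ∈ univ.filter fun t => T.dist t x < T.dist t y := by
      simpa using hT.connected.pos_dist_of_ne hxy.ne
    simpa using h this

lemma solvable_of_le_excess {ω D : V → ℕ} (r : V) (f : V → ℤ)
    (hf : ∀ u, f u ≤ (D u : ℤ) - ω u + ∑ c ∈ rootedChildren T r u, pebTransfer (f c))
    (hr : 0 ≤ f r) : Solvable T ω D := by
  induction hn : ∑ u, D u using Nat.strong_induction_on generalizing D f with
  | _ n ih =>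
  by_cases hω : ∀ u, ω u ≤ D u
  · exact ⟨D, Relation.ReflTransGen.refl, hω⟩
  push Not at hω
  obtain ⟨u₀, hu₀⟩ := hω
  set flow : V → V → Prop := fun x y =>
    (x ∈ rootedChildren T r y ∧ 2 ≤ f x) ∨ (y ∈ rootedChildren T r x ∧ f y < 0) with hflow
  have hadj : ∀ x y, flow x y → T.Adj x y := by
    rintro x y (h | h)
    · exact (mem_rootedChildren.1 h.1).1.symm
    · exact (mem_rootedChildren.1 h.1).1
  have hpos : ∀ x : V, ∀ s ⊆ rootedChildren T r x, 0 < ∑ c ∈ s, pebTransfer (f c) →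
      ∃ c ∈ s, flow c x := by
    intro x s hs hsum
    obtain ⟨c, hc, h⟩ := exists_lt_of_sum_lt (s := s) (f := fun _ => 0)
      (g := fun c => pebTransfer (f c)) (by simpa using hsum)
    refine ⟨c, hc, Or.inl ⟨hs hc, ?_⟩⟩
    unfold pebTransfer at h
    grind
  have hdown : ∀ x, f x < 0 → ∃ p, x ∈ rootedChildren T r p ∧ flow p x := by
    intro x hx
    obtain ⟨p, hp⟩ := hT.exists_mem_rootedChildren (r := r) (c := x) (by rintro rfl; omega)
    exact ⟨p, hp, Or.inr ⟨hp, hx⟩⟩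
  have hstart : ∃ z, flow z u₀ := by
    by_cases hfu : f u₀ < 0
    · obtain ⟨p, -, hp⟩ := hdown _ hfu
      exact ⟨p, hp⟩
    · obtain ⟨c, -, hc⟩ := hpos u₀ _ subset_rfl (by have := hf u₀; omega)
      exact ⟨c, hc⟩
  have hback : ∀ x y, flow x y → D x < 2 → ∃ z, z ≠ y ∧ flow z x := by
    intro x y hxy hD
    rcases hxy with ⟨h1, h2⟩ | ⟨h1, h2⟩
    · obtain ⟨c, hc, hcf⟩ := hpos x _ subset_rfl (by have := hf x; omega)
      refine ⟨c, ?_, hcf⟩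
      rintro rfl
      rw [mem_rootedChildren] at h1 hc
      omega
    · by_cases hfx : f x < 0
      · obtain ⟨p, hp, hpf⟩ := hdown _ hfx
        refine ⟨p, ?_, hpf⟩
        rintro rfl
        rw [mem_rootedChildren] at h1 hp
        omega
      · have h3 := hf x
        rw [← add_sum_erase _ _ h1] at h3
        have h4 : pebTransfer (f y) ≤ -2 := by
          unfold pebTransfer
          grind
        obtain ⟨c, hc, hcf⟩ := hpos x ((rootedChildren T r x).erase y) (erase_subset _ _)
          (by omega)
        exact ⟨c, ne_of_mem_erase hc, hcf⟩
  classical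
  have hsource : ∀ m x y, #{t | T.dist t x < T.dist t y} = m → flow x y →
      ∃ x y, flow x y ∧ 2 ≤ D x := by
    intro m
    induction m using Nat.strong_induction_on with
    | _ m ihm =>
      intro x y hm hxy
      by_cases hD : 2 ≤ D x
      · exact ⟨x, y, hxy, hD⟩
      · obtain ⟨z, hzy, hzx⟩ := hback x y hxy (by omega)
        exact ihm _ (hm ▸ hT.card_filter_dist_lt (hadj _ _ hxy) (hadj _ _ hzx) hzy) z x rfl hzx
  obtain ⟨z, hz⟩ := hstart
  obtain ⟨a, b, hfl, h2⟩ := hsource _ z u₀ rfl hz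
  have hab := hadj a b hfl
  have hne := hab.ne
  set D' : V → ℕ := fun x => if x = a then D a - 2 else if x = b then D b + 1 else D x with hD'
  have hstep : PebStep T D D' := ⟨a, b, hab, h2, rfl⟩
  suffices h : Solvable T ω D' by
    obtain ⟨E, hE, hEω⟩ := h
    exact ⟨E, Relation.ReflTransGen.head hstep hE, hEω⟩
  have hlt : ∑ u, D' u < n := by
    have h1 : ∀ E : V → ℕ, ∑ u, E u = E a + (E b + ∑ u ∈ (univ.erase a).erase b, E u) := by
      intro E
      rw [add_sum_erase _ _ (by simp [hne.symm]), add_sum_erase _ _ (mem_univ _)]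
    have h3 : ∑ u ∈ (univ.erase a).erase b, D' u = ∑ u ∈ (univ.erase a).erase b, D u := by
      refine sum_congr rfl fun u hu => ?_
      simp only [mem_erase, mem_univ, and_true] at hu
      simp [hD', hu.1, hu.2]
    rw [h1, h3, ← hn, h1 D]
    simp only [hD', if_true, if_neg hne.symm]
    omega
  rcases hfl with ⟨ha, hfa⟩ | ⟨hb, hfb⟩
  · refine ih _ hlt (Function.update f a (f a - 2)) (fun u => ?_) ?_ rfl
    · have h1 := hf u
      have h3 : pebTransfer (f a - 2) = pebTransfer (f a) - 1 := by
        unfold pebTransfer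
        grind
      have h4 : a ∈ rootedChildren T r u → u = b := fun h =>
        hT.eq_of_mem_rootedChildren h ha
      rw [sum_pebTransfer_update]
      simp only [hD']
      by_cases hub : u = b
      · subst hub
        rw [Function.update_of_ne hne.symm, if_neg hne.symm]
        simp only [if_pos, ha]
        push_cast
        omega
      · rw [if_neg (fun h => hub (h4 h))]
        by_cases hua : u = a
        · subst hua
          simp only [if_true, Function.update_self]
          push_cast [h2]
          omega
        · rw [if_neg hub, if_neg hua, Function.update_of_ne hua]
          omega
    · rw [Function.update_of_ne]
      · exact hr
      · rintro rfl
        rw [mem_rootedChildren] at ha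
        simp at ha
  · refine ih _ hlt (Function.update f b (f b + 1)) (fun u => ?_) ?_ rfl
    · have h1 := hf u
      have h3 : pebTransfer (f b + 1) = pebTransfer (f b) + 2 := by
        unfold pebTransfer
        grind
      have h4 : b ∈ rootedChildren T r u → u = a := fun h =>
        hT.eq_of_mem_rootedChildren h hb
      rw [sum_pebTransfer_update]
      simp only [hD']
      by_cases hua : u = a
      · subst hua
        rw [Function.update_of_ne hne]
        simp only [if_pos, hb]
        push_cast [h2]
        omega
      · rw [if_neg hua, if_neg (fun h => hua (h4 h))]
        by_cases hub : u = b
        · subst hub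
          simp only [if_true, Function.update_self]
          push_cast
          omega
        · rw [if_neg hub, Function.update_of_ne hub]
          omega
    · rw [Function.update_of_ne]
      · exact hr
      · rintro rfl
        rw [mem_rootedChildren] at hb
        simp at hb

end SimpleGraph.IsTree

lemma lex_of_perm_append {A B M L₁ L₂ : List ℕ} {c : ℕ} (hA : ∀ a ∈ A, a < c)
    (h₁ : L₁.Perm (A ++ M)) (h₂ : L₂.Perm (c :: B ++ M)) (hs : L₂.Pairwise (· ≥ ·)) :
    List.Lex (· < ·) L₁ L₂ := by
  induction L₂ generalizing L₁ M with
  | nil => simpa using h₂.length_eq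
  | cons y L₂ ih =>
    cases L₁ with
    | nil => exact List.Lex.nil
    | cons x L₁ =>
      have hle : ∀ z ∈ c :: B ++ M, z ≤ y := by
        intro z hz
        rcases List.mem_cons.1 (h₂.mem_iff.2 hz) with rfl | hz
        · exact le_rfl
        · exact (List.pairwise_cons.1 hs).1 z hz
      rcases List.mem_append.1 (h₁.mem_iff.1 (List.mem_cons_self ..)) with hx | hx
      · exact List.Lex.rel ((hA x hx).trans_le (hle c (by simp)))
      · rcases (hle x (by simp [hx])).lt_or_eq with hlt | rfl
        · exact List.Lex.rel hlt
        · refine List.Lex.cons (ih (M := M.erase x) ?_ ?_ (List.pairwise_cons.1 hs).2)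
          · have := h₁.trans ((List.perm_cons_erase hx).append_left A)
            exact (this.trans List.perm_middle).cons_inv
          · have := h₂.trans ((List.perm_cons_erase hx).append_left (c :: B))
            exact (this.trans List.perm_middle).cons_inv

lemma exists_perm_cons_of_mem {α : Type*} {a : α} {l : List α} (h : a ∈ l) :
    ∃ l', l.Perm (a :: l') := by
  obtain ⟨s, t, rfl⟩ := List.append_of_mem h
  exact ⟨s ++ t, List.perm_middle⟩

lemma lex_sortDesc {A B M L₁ L₂ : List ℕ} {c : ℕ} (hA : ∀ a ∈ A, a < c)
    (h₁ : L₁.Perm (A ++ M)) (h₂ : L₂.Perm (c :: B ++ M)) :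
    List.Lex (· < ·) (sortDesc L₁) (sortDesc L₂) :=
  lex_of_perm_append hA ((List.perm_insertionSort _ _).trans h₁)
    ((List.perm_insertionSort _ _).trans h₂) (List.pairwise_insertionSort _ _)

namespace SimpleGraph.Walk

variable {G : SimpleGraph V} {φ : V → ℕ}

lemma isPath_of_forall_darts_lt {a b : V} (w : G.Walk a b)
    (h : ∀ d ∈ w.darts, φ d.snd < φ d.fst) : w.IsPath := by
  suffices H : w.IsPath ∧ ∀ x ∈ w.support, φ x ≤ φ a from H.1
  induction w with
  | nil => simp
  | @cons u v _ hp p ih =>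
    obtain ⟨h1, h2⟩ := ih fun d hd => h d (by simp [hd])
    have h3 : φ v < φ u := h ⟨(u, v), hp⟩ (by simp)
    refine ⟨(cons_isPath_iff hp p).2 ⟨h1, fun hu => ?_⟩, ?_⟩
    · exact absurd (h2 u hu) (by omega)
    · intro x hx
      rw [support_cons, List.mem_cons] at hx
      rcases hx with rfl | hx
      · exact le_rfl
      · exact (h2 x hx).trans h3.le

lemma getVert_succ_lt {a b : V} {w : G.Walk a b} (h : ∀ d ∈ w.darts, φ d.snd < φ d.fst)
    {i : ℕ} (hi : i < w.length) : φ (w.getVert (i + 1)) < φ (w.getVert i) := by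
  have hi' : i < w.darts.length := by simpa using hi
  have := h _ (List.getElem_mem hi')
  rwa [darts_getElem_eq_getVert] at this

lemma mk_getVert_succ_mem_edges {a b : V} {w : G.Walk a b} {i : ℕ} (hi : i < w.length) :
    s(w.getVert i, w.getVert (i + 1)) ∈ w.edges := by
  have hi' : i < w.darts.length := by simpa using hi
  have := List.getElem_mem hi'
  rw [darts_getElem_eq_getVert] at this
  exact List.mem_map.2 ⟨_, this, rfl⟩

lemma exists_getVert_of_mem_edges {a b x y : V} {w : G.Walk a b}
    (h : ∀ d ∈ w.darts, φ d.snd < φ d.fst) (hxy : φ y < φ x) (he : s(x, y) ∈ w.edges) :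
    ∃ i < w.length, w.getVert i = x ∧ w.getVert (i + 1) = y := by
  obtain ⟨d, hd, hde⟩ := List.mem_map.1 he
  obtain ⟨i, hi, rfl⟩ := List.getElem_of_mem hd
  have hi' : i < w.length := by simpa using hi
  have h2 := getVert_succ_lt h hi'
  rw [darts_getElem_eq_getVert] at hde
  refine ⟨i, hi', ?_⟩
  rcases Sym2.eq_iff.1 hde with h3 | h3
  · exact h3
  · dsimp only at h3
    rw [h3.1, h3.2] at h2
    omega

end SimpleGraph.Walk

namespace IsPartitionTo

variable {G : SimpleGraph V} {φ : V → ℕ} {P : PathSys G}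

lemma nodup (hP : IsPartitionTo G φ P) : P.Nodup := by
  refine hP.2.1.imp_of_mem fun {q r} hq _ h heq => ?_
  subst heq
  have := Walk.mk_getVert_succ_mem_edges (hP.1 q hq).2.1
  exact h _ this this

lemma eq_of_mem_edges (hP : IsPartitionTo G φ P) {q r : Σ a : V, Σ b : V, G.Walk a b} (hq : q ∈ P)
    (hr : r ∈ P) {e : Sym2 V} (h1 : e ∈ q.2.2.edges) (h2 : e ∈ r.2.2.edges) : q = r := by
  by_contra hne
  have : Std.Symm (fun q r : Σ a : V, Σ b : V, G.Walk a b =>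
      ∀ e ∈ q.2.2.edges, e ∉ r.2.2.edges) := ⟨fun x y h e h1 h2 => h e h2 h1⟩
  exact hP.2.1.forall hq hr hne e h1 h2

/-- Splicing a path that ends in an inner vertex of another, where the part before that vertex
is shorter, yields a lexicographically larger partition. -/
lemma exists_lex_lt (hP : IsPartitionTo G φ P) {a b c d : V} {w₁ : G.Walk a b} {w₂ : G.Walk c d}
    {j : ℕ} (h₁ : ⟨a, b, w₁⟩ ∈ P) (h₂ : ⟨c, d, w₂⟩ ∈ P) (hb : b = w₂.getVert j)
    (hj₂ : j < w₂.length) (hj₁ : j < w₁.length) :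
    ∃ Q, IsPartitionTo G φ Q ∧
      List.Lex (· < ·) (sortDesc (sysLengths P)) (sortDesc (sysLengths Q)) := by
  have hp₂ := (hP.1 _ h₂).1
  have hne : (⟨c, d, w₂⟩ : Σ a : V, Σ b : V, G.Walk a b) ≠ ⟨a, b, w₁⟩ := by
    intro h
    obtain ⟨rfl, h⟩ := Sigma.mk.inj_iff.1 h
    obtain ⟨rfl, -⟩ := Sigma.mk.inj_iff.1 (eq_of_heq h)
    have := hp₂.getVert_injOn (Set.mem_ofPred.2 hj₂.le) (Set.mem_ofPred.2 le_rfl)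
      (by rw [← hb, Walk.getVert_length])
    dsimp only at this
    omega
  subst hb
  obtain ⟨P₁, hP₁⟩ := exists_perm_cons_of_mem h₁
  obtain ⟨P₂, hP₂⟩ := exists_perm_cons_of_mem
    ((List.mem_cons.1 (hP₁.mem_iff.1 h₂)).resolve_left hne)
  have hperm := hP₁.trans (hP₂.cons _)
  have hpw := (hperm.pairwise_iff (fun h e h1 h2 => h e h2 h1)).1 hP.2.1
  rw [List.pairwise_cons, List.pairwise_cons] at hpw
  have hmem := fun q => hperm.mem_iff (a := q)
  simp only [List.mem_cons] at hmem
  have hd₁ := (hP.1 _ h₁).2.2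
  have hd₂ := (hP.1 _ h₂).2.2
  have h12 := hpw.1 _ (List.mem_cons_self ..)
  have h1P : ∀ q ∈ P₂, ∀ e ∈ w₁.edges, e ∉ q.2.2.edges := fun q hq =>
    hpw.1 q (List.mem_cons_of_mem _ hq)
  have h2P : ∀ q ∈ P₂, ∀ e ∈ w₂.edges, e ∉ q.2.2.edges := hpw.2.1
  dsimp only at hd₁ hd₂ h12
  set t : Σ a : V, Σ b : V, G.Walk a b := ⟨c, w₂.getVert j, w₂.take j⟩
  set R : PathSys G := if 0 < j then [t] else [] with hR
  have hmR : ∀ q ∈ R, q = t ∧ 0 < j := by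
    intro q hq
    rw [hR] at hq
    split_ifs at hq with hj
    · exact ⟨by simpa using hq, hj⟩
    · simp at hq
  have htake : ∀ e ∈ (w₂.take j).edges, e ∈ w₂.edges := fun e he => by
    rw [Walk.edges_take] at he
    exact List.mem_of_mem_take he
  have hdrop : ∀ e ∈ (w₂.drop j).edges, e ∈ w₂.edges := fun e he => by
    rw [Walk.edges_drop] at he
    exact List.mem_of_mem_drop he
  have htd : ∀ e ∈ (w₂.drop j).edges, e ∉ (w₂.take j).edges := fun e h1 h2 => by
    have := hp₂.isTrail.edges_nodup
    rw [← List.take_append_drop j w₂.edges, List.nodup_append] at this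
    rw [Walk.edges_take] at h2
    rw [Walk.edges_drop] at h1
    exact this.2.2 e h2 e h1 rfl
  have hds : ∀ e ∈ (w₁.append (w₂.drop j)).darts, φ e.snd < φ e.fst := by
    intro e he
    rw [Walk.darts_append, List.mem_append, Walk.darts_drop] at he
    rcases he with he | he
    · exact hd₁ e he
    · exact hd₂ e (List.mem_of_mem_drop he)
  have hdt : ∀ e ∈ (w₂.take j).darts, φ e.snd < φ e.fst := by
    intro e he
    rw [Walk.darts_take] at he
    exact hd₂ e (List.mem_of_mem_take he)
  refine ⟨⟨a, d, w₁.append (w₂.drop j)⟩ :: (R ++ P₂), ⟨?_, ?_, ?_⟩, ?_⟩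
  · intro q hq
    rw [List.mem_cons, List.mem_append] at hq
    rcases hq with rfl | hq | hq
    · refine ⟨Walk.isPath_of_forall_darts_lt _ hds, ?_, hds⟩
      rw [Walk.length_append]
      omega
    · obtain ⟨rfl, hj⟩ := hmR q hq
      refine ⟨Walk.isPath_of_forall_darts_lt _ hdt, ?_, hdt⟩
      change 0 < (w₂.take j).length
      rw [Walk.take_length]
      omega
    · exact hP.1 q ((hmem q).2 (Or.inr (Or.inr hq)))
  · rw [List.pairwise_cons, List.pairwise_append]
    refine ⟨fun q hq e he => ?_, ?_, hpw.2.2, fun q hq r hr e he => ?_⟩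
    · rw [Walk.edges_append, List.mem_append] at he
      rcases List.mem_append.1 hq with hq | hq
      · obtain ⟨rfl, -⟩ := hmR q hq
        rcases he with he | he
        · exact fun h => h12 e he (htake e h)
        · exact htd e he
      · rcases he with he | he
        · exact h1P q hq e he
        · exact h2P q hq e (hdrop e he)
    · rw [hR]
      split_ifs <;> simp
    · obtain ⟨rfl, -⟩ := hmR q hq
      exact h2P r hr e (htake e he)
  · intro x y hxy hlt
    obtain ⟨q, hq, he⟩ := hP.2.2 x y hxy hlt
    rcases (hmem q).1 hq with rfl | rfl | hq
    · refine ⟨_, List.mem_cons_self .., ?_⟩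
      rw [Walk.edges_append]
      exact List.mem_append_left _ he
    · dsimp only at he
      rw [← List.take_append_drop j w₂.edges, List.mem_append] at he
      rcases he with he | he
      · have hj : 0 < j := by
          by_contra hj
          simp [Nat.eq_zero_of_not_pos hj] at he
        refine ⟨t, by simp [hR, hj], ?_⟩
        change s(x, y) ∈ (w₂.take j).edges
        rwa [Walk.edges_take]
      · refine ⟨_, List.mem_cons_self .., ?_⟩
        rw [Walk.edges_append, Walk.edges_drop]
        exact List.mem_append_right _ he
    · exact ⟨q, by simp [hq], he⟩
  · refine lex_sortDesc (A := [w₁.length, w₂.length]) (M := sysLengths P₂) (B := sysLengths R)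
      (c := w₁.length + (w₂.length - j)) ?_ ?_ ?_
    · simp only [List.mem_cons, List.not_mem_nil, or_false]
      rintro x (rfl | rfl) <;> omega
    · exact hperm.map _
    · simp [sysLengths]

variable {O : Finset V} {ht : V → ℕ}

lemma height_getVert (hP : IsMaxPartitionTo G φ P)
    (hφ : ∀ a b c, G.Adj a b → G.Adj a c → φ b < φ a → φ c < φ a → b = c)
    (hO : ∀ a, a ∈ O ↔ ∃ b, G.Adj a b ∧ φ b < φ a)
    (h₁ : ∀ a b, G.Adj a b → φ b < φ a → b ∈ O → ht a + 1 ≤ ht b)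
    (h₂ : ∀ b ∈ O, 0 < ht b → ∃ a, G.Adj a b ∧ φ b < φ a ∧ ht a + 1 = ht b)
    {q : Σ a : V, Σ b : V, G.Walk a b} (hq : q ∈ P) {j : ℕ} (hj : j < q.2.2.length) :
    ht (q.2.2.getVert j) = j := by
  obtain ⟨hP, hmax⟩ := hP
  have hmemO : ∀ q ∈ P, ∀ j < q.2.2.length, q.2.2.getVert j ∈ O := fun q hq j hj =>
    (hO _).2 ⟨_, q.2.2.adj_getVert_succ hj, Walk.getVert_succ_lt (hP.1 q hq).2.2 hj⟩
  induction hn : ht (q.2.2.getVert j) using Nat.strong_induction_on generalizing q j with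
  | _ n ih =>
  have hge : ∀ i, i < q.2.2.length → i ≤ ht (q.2.2.getVert i) := by
    intro i hi
    induction i with
    | zero => exact Nat.zero_le _
    | succ i ihi =>
      have := h₁ _ _ (q.2.2.adj_getVert_succ (by omega : i < q.2.2.length))
        (Walk.getVert_succ_lt (hP.1 q hq).2.2 (by omega)) (hmemO q hq _ hi)
      have := ihi (by omega)
      omega
  have hjn := hge j hj
  by_contra hne
  obtain ⟨c, hc, hφc, hhc⟩ := h₂ _ (hmemO q hq j hj) (by omega)
  obtain ⟨r, hr, he⟩ := hP.2.2 c _ hc hφc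
  obtain ⟨i, hi, rfl, hi'⟩ := Walk.exists_getVert_of_mem_edges (hP.1 r hr).2.2 hφc he
  have hieq := ih _ (by omega) hr hi rfl
  by_cases hend : i + 1 < r.2.2.length
  · have hnext : r.2.2.getVert (i + 1 + 1) = q.2.2.getVert (j + 1) := by
      refine hφ (q.2.2.getVert j) _ _ ?_ (q.2.2.adj_getVert_succ hj) ?_
        (Walk.getVert_succ_lt (hP.1 q hq).2.2 hj)
      · rw [← hi']
        exact r.2.2.adj_getVert_succ hend
      · rw [← hi']
        exact Walk.getVert_succ_lt (hP.1 r hr).2.2 hend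
    have he₁ := Walk.mk_getVert_succ_mem_edges hend
    rw [hnext, hi'] at he₁
    obtain rfl := hP.eq_of_mem_edges hr hq he₁ (Walk.mk_getVert_succ_mem_edges hj)
    have := (hP.1 r hr).1.getVert_injOn (Set.mem_ofPred.2 hend.le) (Set.mem_ofPred.2 hj.le) hi'
    omega
  · have hlen : i + 1 = r.2.2.length := by omega
    obtain ⟨a, b, w⟩ := r
    obtain ⟨a', b', w'⟩ := q
    dsimp only at *
    rw [hlen, Walk.getVert_length] at hi'
    obtain ⟨Q, hQ, hlex⟩ := hP.exists_lex_lt hr hq hi' hj (by omega)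
    exact hmax Q hQ hlex

lemma pathsExtra_eq (hP : IsMaxPartitionTo G φ P)
    (hφ : ∀ a b c, G.Adj a b → G.Adj a c → φ b < φ a → φ c < φ a → b = c)
    (hO : ∀ a, a ∈ O ↔ ∃ b, G.Adj a b ∧ φ b < φ a)
    (h₁ : ∀ a b, G.Adj a b → φ b < φ a → b ∈ O → ht a + 1 ≤ ht b)
    (h₂ : ∀ b ∈ O, 0 < ht b → ∃ a, G.Adj a b ∧ φ b < φ a ∧ ht a + 1 = ht b) :
    pathsExtra P = ∑ a ∈ O, 2 ^ ht a := by
  have hht := fun q (hq : q ∈ P) j (hj : j < q.2.2.length) =>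
    height_getVert hP hφ hO h₁ h₂ hq hj
  obtain ⟨hP, -⟩ := hP
  set verts : (Σ a : V, Σ b : V, G.Walk a b) → List V := fun q =>
    (List.range q.2.2.length).map q.2.2.getVert with hverts
  have hmem : ∀ q x, x ∈ verts q ↔ ∃ j < q.2.2.length, q.2.2.getVert j = x := by
    simp [hverts]
  have hnodup : (P.flatMap verts).Nodup := by
    rw [List.nodup_flatMap]
    refine ⟨fun q hq => ?_, hP.nodup.imp_of_mem fun {q r} hq hr hne => ?_⟩
    · refine List.Nodup.map_on (fun i hi j hj h => ?_) List.nodup_range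
      rw [List.mem_range] at hi hj
      exact (hP.1 q hq).1.getVert_injOn (Set.mem_ofPred.2 hi.le) (Set.mem_ofPred.2 hj.le) h
    · intro x hxq hxr
      obtain ⟨i, hi, rfl⟩ := (hmem _ _).1 hxq
      obtain ⟨j, hj, hji⟩ := (hmem _ _).1 hxr
      have hnext : r.2.2.getVert (j + 1) = q.2.2.getVert (i + 1) := by
        refine hφ (q.2.2.getVert i) _ _ ?_ (q.2.2.adj_getVert_succ hi) ?_
          (Walk.getVert_succ_lt (hP.1 q hq).2.2 hi)
        · rw [← hji]
          exact r.2.2.adj_getVert_succ hj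
        · rw [← hji]
          exact Walk.getVert_succ_lt (hP.1 r hr).2.2 hj
      have he := Walk.mk_getVert_succ_mem_edges hj
      rw [hnext, hji] at he
      exact hne (hP.eq_of_mem_edges hq hr (Walk.mk_getVert_succ_mem_edges hi) he)
  have hset : (P.flatMap verts).toFinset = O := by
    ext x
    rw [List.mem_toFinset, List.mem_flatMap, hO]
    constructor
    · rintro ⟨q, hq, hx⟩
      obtain ⟨i, hi, rfl⟩ := (hmem _ _).1 hx
      exact ⟨_, q.2.2.adj_getVert_succ hi, Walk.getVert_succ_lt (hP.1 q hq).2.2 hi⟩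
    · rintro ⟨y, hxy, hlt⟩
      obtain ⟨q, hq, he⟩ := hP.2.2 x y hxy hlt
      obtain ⟨i, hi, hix, -⟩ := Walk.exists_getVert_of_mem_edges (hP.1 q hq).2.2 hlt he
      exact ⟨q, hq, (hmem _ _).2 ⟨i, hi, hix⟩⟩
  rw [← hset, List.sum_toFinset _ hnodup, List.flatMap_def, List.map_flatten,
    List.sum_flatten, pathsExtra, sysLengths, List.map_map, List.map_map, List.map_map]
  congr 1
  refine List.map_congr_left fun q hq => ?_
  have : (verts q).map (fun a => 2 ^ ht a) = (List.range q.2.2.length).map (2 ^ ·) := by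
    rw [hverts, List.map_map]
    refine List.map_congr_left fun j hj => ?_
    rw [Function.comp_apply, hht q hq j (List.mem_range.1 hj)]
  simp only [Function.comp_apply, this]
  have h := Nat.geomSum_eq le_rfl q.2.2.length
  rw [Nat.div_one] at h
  exact h.symm

end IsPartitionTo

open Classical in
/-- The largest distance from `u` to a vertex whose geodesic from `v` passes through `u`. -/
noncomputable def rootedHeight [Fintype V] (T : SimpleGraph V) (v u : V) : ℕ :=
  (univ.filter fun x => T.dist v x = T.dist v u + T.dist u x).sup (T.dist u)

lemma dist_le_rootedHeight [Fintype V] {T : SimpleGraph V} {v u x : V}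
    (h : T.dist v x = T.dist v u + T.dist u x) : T.dist u x ≤ rootedHeight T v u := by
  classical
  exact le_sup (f := T.dist u) (by simpa using h)

lemma exists_dist_eq_rootedHeight [Fintype V] (T : SimpleGraph V) (v u : V) :
    ∃ x, T.dist v x = T.dist v u + T.dist u x ∧ T.dist u x = rootedHeight T v u := by
  classical
  obtain ⟨x, hx, h⟩ := exists_mem_eq_sup
    (univ.filter fun x => T.dist v x = T.dist v u + T.dist u x) ⟨u, by simp⟩ (T.dist u)
  exact ⟨x, by simpa using hx, h.symm⟩

/-- A function satisfying a recursive specification along a measure exists. -/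
lemma exists_recursive {α β : Type*} [Inhabited β] (μ : α → ℕ) (Φ : α → (α → β) → β) :
    ∃ F : α → β, ∀ a, F a = Φ a fun b => if μ b < μ a then F b else default := by
  refine ⟨(measure μ).wf.fix fun a rec => Φ a fun b => if h : μ b < μ a then rec b h else default,
    fun a => ?_⟩
  rw [WellFounded.fix_eq]
  congr 1

namespace SimpleGraph.IsTree

variable [Fintype V] {T : SimpleGraph V} (hT : T.IsTree)
include hT

lemma dist_of_mem_rootedChildren {r a b : V} (h : b ∈ rootedChildren T r a) :
    T.dist r b = T.dist r a + 1 := by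
  rw [mem_rootedChildren] at h
  have := hT.dist_eq_dist_add_one_of_adj r h.1
  omega

lemma dist_of_mem_rootedChildren_of_dist {v u c x : V} (hc : c ∈ rootedChildren T v u)
    (h : T.dist v x = T.dist v c + T.dist c x) :
    T.dist v x = T.dist v u + T.dist u x ∧ T.dist u x = T.dist c x + 1 := by
  have h1 := hT.dist_of_mem_rootedChildren hc
  rw [mem_rootedChildren] at hc
  have h2 := hT.dist_lt_of_dist_eq_add hc.2 h
  rw [dist_comm, dist_comm (u := x)] at h2
  have h3 := hT.connected.dist_triangle (u := u) (v := c) (w := x)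
  rw [dist_eq_one_iff_adj.2 hc.1] at h3
  omega

lemma exists_mem_rootedChildren_dist {v u x : V} (hx : x ≠ u)
    (h : T.dist v x = T.dist v u + T.dist u x) :
    ∃ c ∈ rootedChildren T v u, T.dist v x = T.dist v c + T.dist c x ∧
      T.dist u x = T.dist c x + 1 := by
  obtain ⟨c, hc, hd⟩ := hT.exists_closer (x := x) hx.symm
  rw [dist_comm, dist_comm (u := x)] at hd
  have h3 := hT.connected.dist_triangle (u := v) (v := c) (w := x)
  have h4 := hT.dist_eq_dist_add_one_of_adj v hc
  exact ⟨c, mem_rootedChildren.2 ⟨hc, by omega⟩, by omega, by omega⟩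

lemma rootedHeight_add_one_le {v u c : V} (hc : c ∈ rootedChildren T v u) :
    rootedHeight T v c + 1 ≤ rootedHeight T v u := by
  obtain ⟨x, hx, h⟩ := exists_dist_eq_rootedHeight T v c
  obtain ⟨h1, h2⟩ := hT.dist_of_mem_rootedChildren_of_dist hc hx
  have := dist_le_rootedHeight h1
  omega

lemma exists_rootedHeight_add_one_eq {v u : V} (h : 0 < rootedHeight T v u) :
    ∃ c ∈ rootedChildren T v u, rootedHeight T v c + 1 = rootedHeight T v u := by
  obtain ⟨x, hx, h1⟩ := exists_dist_eq_rootedHeight T v u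
  obtain ⟨c, hc, h2, h3⟩ := hT.exists_mem_rootedChildren_dist
    (by rintro rfl; simp at h1; omega) hx
  have h4 := dist_le_rootedHeight h2
  have h5 := hT.rootedHeight_add_one_le hc
  exact ⟨c, hc, by omega⟩

/-- There is a function sending each non-root vertex to its parent. -/
lemma exists_parent (r : V) : ∃ p : V → V, ∀ c, c ≠ r → c ∈ rootedChildren T r (p c) := by
  refine ⟨fun c => if h : c = r then r else (hT.exists_mem_rootedChildren h).choose, fun c hc => ?_⟩
  simp only [dif_neg hc]
  exact (hT.exists_mem_rootedChildren hc).choose_spec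

lemma sum_rootedChildren {r : V} {p : V → V} (hp : ∀ c, c ≠ r → c ∈ rootedChildren T r (p c))
    (F : V → V → ℤ) :
    ∑ u, ∑ c ∈ rootedChildren T r u, F u c = ∑ c ∈ univ.erase r, F (p c) c := by
  rw [sum_comm' (t' := univ.erase r) (s' := fun c => {p c})]
  · simp
  · intro u c
    simp only [mem_univ, true_and, mem_singleton, mem_erase, and_true]
    constructor
    · intro h
      have hc : c ≠ r := by
        rintro rfl
        rw [mem_rootedChildren] at h
        simp at h
      exact ⟨hT.eq_of_mem_rootedChildren h (hp c hc), hc⟩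
    · rintro ⟨rfl, hc⟩
      exact hp c hc

lemma pathsExtra_eq_sum {ω : V → ℕ} {v : V} {P : PathSys T}
    (hP : IsMaxPartitionTo T (phiOmega T ω v) P) {O : Finset V}
    (hO : ∀ u, u ∈ O ↔ u ∉ subtreeSpan T (insert v {w | 0 < ω w})) :
    pathsExtra P = ∑ u ∈ O, 2 ^ rootedHeight T v u := by
  have key : ∀ a b, T.Adj a b → (phiOmega T ω v b < phiOmega T ω v a ↔
      a ∉ subtreeSpan T (insert v {w | 0 < ω w}) ∧ T.dist v b < T.dist v a) :=
    fun a b hab => hT.distToSet_lt_iff hab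
  refine IsPartitionTo.pathsExtra_eq hP (fun a b c hb hc h1 h2 => ?_) (fun a => ?_)
    (fun a b hab h hb => ?_) fun b hb h => ?_
  · rw [key _ _ hb] at h1
    rw [key _ _ hc] at h2
    exact hT.closer_unique hb hc h1.2 h2.2
  · rw [hO]
    constructor
    · intro ha
      have hav : a ≠ v := by
        rintro rfl
        exact ha (hT.mem_subtreeSpan_insert_iff.2 ⟨a, by simp, by simp⟩)
      obtain ⟨b, hab, hb⟩ := hT.exists_closer hav
      exact ⟨b, hab, (key _ _ hab).2 ⟨ha, by omega⟩⟩
    · rintro ⟨b, hab, h⟩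
      exact ((key _ _ hab).1 h).1
  · exact hT.rootedHeight_add_one_le (mem_rootedChildren.2 ⟨hab.symm, ((key _ _ hab).1 h).2⟩)
  · obtain ⟨c, hc, hh⟩ := hT.exists_rootedHeight_add_one_eq h
    rw [mem_rootedChildren] at hc
    refine ⟨c, hc.1.symm, (key _ _ hc.1.symm).2 ⟨fun h => (hO b).1 hb ?_, hc.2⟩, hh⟩
    exact hT.mem_subtreeSpan_of_dist_lt hc.1.symm hc.2 h

end SimpleGraph.IsTree

namespace SimpleGraph.IsTree

variable [Fintype V] {T : SimpleGraph V} (hT : T.IsTree)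
include hT

/-- If `D` is not solvable, then the excess `F u p` that the branch at `u` away from its
neighbour `p` holds is negative on at least one side of each edge, and is negative in total
from the point of view of each root `r`. -/
lemma exists_excess_of_not_solvable {ω D : V → ℕ} (hD : ¬ Solvable T ω D) :
    ∃ F : V → V → ℤ, (∀ a b, T.Adj a b → ¬ (0 ≤ F a b ∧ 0 ≤ F b a)) ∧
      ∀ r, ∃ f : V → ℤ, f r < 0 ∧
        (∀ u, f u = (D u : ℤ) - ω u + ∑ c ∈ rootedChildren T r u, pebTransfer (f c)) ∧
        ∀ u, ∀ c ∈ rootedChildren T r u, f c = F c u := by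
  classical
  obtain ⟨F', hF'⟩ := exists_recursive (fun a : V × V => #{t | T.dist t a.1 < T.dist t a.2})
    fun (a : V × V) (rec : V × V → ℤ) => (D a.1 : ℤ) - ω a.1 +
      ∑ c with T.Adj a.1 c ∧ c ≠ a.2, pebTransfer (rec (c, a.1))
  set F : V → V → ℤ := fun u p => F' (u, p) with hFdef
  have hF : ∀ u p, T.Adj u p →
      F u p = (D u : ℤ) - ω u + ∑ c with T.Adj u c ∧ c ≠ p, pebTransfer (F c u) := by
    intro u p hup
    rw [hFdef]
    beta_reduce
    rw [hF']
    refine congrArg₂ _ rfl (sum_congr rfl fun c hc => ?_)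
    simp only [mem_filter, mem_univ, true_and] at hc
    exact congrArg pebTransfer (if_pos (hT.card_filter_dist_lt hup hc.1.symm hc.2))
  have hcert : ∀ r, ∃ f : V → ℤ,
      (∀ u, f u = (D u : ℤ) - ω u + ∑ c ∈ rootedChildren T r u, pebTransfer (f c)) ∧
        ∀ u, ∀ c ∈ rootedChildren T r u, f c = F c u := by
    intro r
    obtain ⟨p, hp⟩ := hT.exists_parent r
    set f : V → ℤ := fun u => if u = r then
      (D r : ℤ) - ω r + ∑ c ∈ rootedChildren T r r, pebTransfer (F c r) else F u (p u) with hf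
    have hfc : ∀ u, ∀ c ∈ rootedChildren T r u, f c = F c u := by
      intro u c hc
      have hcr : c ≠ r := by
        rintro rfl
        rw [mem_rootedChildren] at hc
        simp at hc
      simp only [hf, if_neg hcr]
      rw [hT.eq_of_mem_rootedChildren (hp c hcr) hc]
    refine ⟨f, fun u => ?_, hfc⟩
    rw [sum_congr rfl fun c hc => by rw [hfc u c hc]]
    by_cases hur : u = r
    · subst hur
      simp [hf]
    · simp only [hf, if_neg hur]
      have hpu := hp u hur
      rw [mem_rootedChildren] at hpu
      rw [hF u _ hpu.1.symm]
      refine congrArg₂ _ rfl (sum_congr ?_ fun _ _ => rfl)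
      ext c
      rw [mem_rootedChildren]
      simp only [mem_filter, mem_univ, true_and]
      refine and_congr_right fun huc => ⟨fun hne => ?_, ?_⟩
      · by_contra hlt
        have := hT.dist_eq_dist_add_one_of_adj r huc
        exact hne (hT.closer_unique huc hpu.1.symm (x := r) (by omega) hpu.2)
      · rintro h rfl
        omega
  have hneg : ∀ r, ∃ f : V → ℤ, f r < 0 ∧
        (∀ u, f u = (D u : ℤ) - ω u + ∑ c ∈ rootedChildren T r u, pebTransfer (f c)) ∧
        ∀ u, ∀ c ∈ rootedChildren T r u, f c = F c u := by
    intro r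
    obtain ⟨f, hf, hfF⟩ := hcert r
    refine ⟨f, ?_, hf, hfF⟩
    by_contra hr
    exact hD (hT.solvable_of_le_excess r f (fun u => (hf u).le) (by omega))
  refine ⟨F, ?_, hneg⟩
  rintro a b hab ⟨h1, h2⟩
  obtain ⟨f, hfb, hf, hfF⟩ := hneg b
  have hmem : a ∈ rootedChildren T b b := by
    rw [mem_rootedChildren, dist_self]
    exact ⟨hab.symm, hT.connected.pos_dist_of_ne hab.ne'⟩
  have h3 := hf b
  rw [← add_sum_erase _ _ hmem, hfF b a hmem] at h3
  have h4 := hF b a hab.symm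
  have h5 : ∑ c ∈ (rootedChildren T b b).erase a, pebTransfer (f c) =
      ∑ c with T.Adj b c ∧ c ≠ a, pebTransfer (F c b) := by
    refine sum_congr ?_ fun c hc => ?_
    · ext c
      rw [mem_erase, mem_rootedChildren]
      simp only [mem_filter, mem_univ, true_and, dist_self]
      refine ⟨fun h => ⟨h.2.1, h.1⟩, fun h => ⟨h.2, h.1, ?_⟩⟩
      exact hT.connected.pos_dist_of_ne h.1.ne
    · rw [hfF b c]
      simp only [mem_filter, mem_univ, true_and] at hc
      rw [mem_rootedChildren, dist_self]
      exact ⟨hc.1, hT.connected.pos_dist_of_ne hc.1.ne⟩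
  have h6 := pebTransfer_nonneg h1
  omega

/-- For a relation holding in at most one direction along each edge, there is a root from which
the number of steps against the relation minus the number of steps along it is never negative. -/
lemma exists_level (U : V → V → Prop) (hU : ∀ a b, T.Adj a b → ¬ (U a b ∧ U b a)) :
    ∃ v, ∃ k : V → ℕ, k v = 0 ∧ ∀ u, ∀ c ∈ rootedChildren T v u,
      (U c u → k u = k c + 1) ∧ (¬ U c u → k c = k u + 1) := by
  classical
  set σ : V → V → ℤ := fun a b => if U a b then -1 else 1 with hσ
  have hℓ : ∀ r, ∃ ℓ : V → ℤ, ℓ r = 0 ∧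
      ∀ u, ∀ c ∈ rootedChildren T r u, ℓ c = ℓ u + σ c u := by
    intro r
    obtain ⟨p, hp⟩ := hT.exists_parent r
    obtain ⟨ℓ, hℓ⟩ := exists_recursive (T.dist r) fun (a : V) (rec : V → ℤ) =>
      if a = r then 0 else rec (p a) + σ a (p a)
    refine ⟨ℓ, by simp [hℓ r], fun u c hc => ?_⟩
    have hcr : c ≠ r := by
      rintro rfl
      rw [mem_rootedChildren] at hc
      simp at hc
    rw [hℓ c, if_neg hcr, hT.eq_of_mem_rootedChildren (hp c hcr) hc]
    beta_reduce
    rw [if_pos (mem_rootedChildren.1 hc).2]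
  choose ℓ hℓ0 hℓ using hℓ
  have htri : ∀ n r v u, T.dist v u = n → ℓ r u ≤ ℓ r v + ℓ v u := by
    intro n
    induction n with
    | zero =>
      intro r v u h
      obtain rfl := hT.connected.dist_eq_zero_iff.1 h
      simp [hℓ0]
    | succ n ih =>
      intro r v u h
      obtain ⟨p, hp⟩ := hT.exists_mem_rootedChildren (r := v) (c := u)
        (by rintro rfl; simp at h)
      have h1 := hT.dist_of_mem_rootedChildren hp
      have h2 := ih r v p (by omega)
      have h3 := hℓ v p u hp
      have hadj := (mem_rootedChildren.1 hp).1
      rcases hT.mem_rootedChildren_or r hadj with h4 | h4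
      · have := hℓ r _ _ h4
        omega
      · have h5 := hℓ r _ _ h4
        have h6 : 0 ≤ σ p u + σ u p := by
          have := hU p u hadj
          simp only [hσ]
          split_ifs <;> first | omega | tauto
        omega
  obtain ⟨r⟩ := hT.connected.nonempty
  obtain ⟨v, -, hv⟩ := exists_min_image univ (ℓ r) ⟨r, mem_univ r⟩
  have hnn : ∀ u, 0 ≤ ℓ v u := fun u => by
    have h1 := htri _ r v u rfl
    have h2 := hv u (mem_univ u)
    omega
  refine ⟨v, fun u => (ℓ v u).toNat, by simp [hℓ0], fun u c hc => ?_⟩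
  have h1 := hℓ v u c hc
  have h2 := hnn u
  have h3 := hnn c
  simp only [hσ] at h1
  beta_reduce
  split_ifs at h1 with h
  · exact ⟨fun _ => by omega, fun h' => absurd h h'⟩
  · exact ⟨fun h' => absurd h' h, fun _ => by omega⟩

lemma dist_add_of_dist_add_child {v p u c : V} (hu : u ∈ rootedChildren T v p) (hc : c ≠ u)
    (h : T.dist v u = T.dist v c + T.dist c u) : T.dist v p = T.dist v c + T.dist c p := by
  obtain ⟨q, hq, hqd⟩ := hT.exists_closer hc.symm
  have h1 := hT.connected.dist_triangle (u := v) (v := c) (w := q)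
  have h2 := hT.dist_of_mem_rootedChildren hu
  rw [mem_rootedChildren] at hu
  obtain rfl := hT.closer_unique (x := v) hq hu.1.symm (by omega) hu.2
  omega

open Classical in
lemma sum_two_pow_le {v : V} {k : V → ℕ} (hkv : k v = 0) {U : V → Prop}
    (hk : ∀ u, ∀ c ∈ rootedChildren T v u, (U c → k u = k c + 1) ∧ (¬ U c → k c = k u + 1))
    (u : V) : (∑ c with c ≠ v ∧ U c ∧ T.dist v u = T.dist v c + T.dist c u, 2 ^ k c) + 2 ^ k u ≤
      2 ^ T.dist v u := by
  induction hn : T.dist v u generalizing u with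
  | zero =>
    obtain rfl := hT.connected.dist_eq_zero_iff.1 hn
    rw [filter_false_of_mem, sum_empty, hkv]
    · simp
    rintro c - ⟨h1, -, h⟩
    exact h1 (hT.connected.dist_eq_zero_iff.1 (by omega)).symm
  | succ n ih =>
    obtain ⟨p, hp⟩ := hT.exists_mem_rootedChildren (r := v) (c := u)
      (by rintro rfl; simp at hn)
    have h1 := hT.dist_of_mem_rootedChildren hp
    have hpn : T.dist v p = n := by omega
    have h2 := ih p hpn
    have h3 := hk p u hp
    by_cases hU : U u
    · have h4 : (∑ c with c ≠ v ∧ U c ∧ n + 1 = T.dist v c + T.dist c u, 2 ^ k c) ≤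
          2 ^ k u + ∑ c with c ≠ v ∧ U c ∧ n = T.dist v c + T.dist c p, 2 ^ k c := by
        have hnot : u ∉ univ.filter fun c => c ≠ v ∧ U c ∧ n = T.dist v c + T.dist c p := by
          simp only [mem_filter, not_and]
          intros
          omega
        rw [← sum_insert (f := fun c => 2 ^ k c) hnot]
        refine sum_le_sum_of_subset fun c hc => ?_
        simp only [mem_filter, mem_univ, true_and, mem_insert] at hc ⊢
        by_cases hcu : c = u
        · exact Or.inl hcu
        · have := hT.dist_add_of_dist_add_child hp hcu (by omega)
          exact Or.inr ⟨hc.1, hc.2.1, by omega⟩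
      rw [h3.1 hU, pow_succ] at h2
      rw [pow_succ]
      omega
    · have h4 : (∑ c with c ≠ v ∧ U c ∧ n + 1 = T.dist v c + T.dist c u, 2 ^ k c) ≤
          ∑ c with c ≠ v ∧ U c ∧ n = T.dist v c + T.dist c p, 2 ^ k c := by
        refine sum_le_sum_of_subset fun c hc => ?_
        simp only [mem_filter, mem_univ, true_and] at hc ⊢
        have hcu : c ≠ u := by
          rintro rfl
          exact hU hc.2.1
        have := hT.dist_add_of_dist_add_child hp hcu (by omega)
        exact ⟨hc.1, hc.2.1, by omega⟩
      rw [h3.2 hU, pow_succ, pow_succ]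
      omega

end SimpleGraph.IsTree

namespace SimpleGraph.IsTree

variable [Fintype V] {T : SimpleGraph V} (hT : T.IsTree)
include hT

lemma sum_lt_of_not_solvable {ω D : V → ℕ} (hD : ¬ Solvable T ω D) :
    ∃ v, ∀ O : Finset V, (∀ u, u ∈ O ↔ u ∉ subtreeSpan T (insert v {w | 0 < ω w})) →
      ∑ u, D u < ∑ u, ω u * 2 ^ T.dist v u + ∑ u ∈ O, 2 ^ rootedHeight T v u := by
  classical
  obtain ⟨F, hF, hcert⟩ := hT.exists_excess_of_not_solvable hD
  obtain ⟨v, k, hkv, hk'⟩ := hT.exists_level (fun a b => 0 ≤ F a b) hF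
  obtain ⟨f, hfv, hf, hfF⟩ := hcert v
  refine ⟨v, fun O hO => ?_⟩
  have hk : ∀ u, ∀ c ∈ rootedChildren T v u,
      (0 ≤ f c → k u = k c + 1) ∧ (¬ 0 ≤ f c → k c = k u + 1) := fun u c hc => by
    rw [hfF u c hc]
    exact hk' u c hc
  have hvO : v ∉ O := fun h => (hO v).1 h (hT.mem_subtreeSpan_insert_iff.2 ⟨v, by simp, by simp⟩)
  have hωO : ∀ u ∈ O, ω u = 0 := fun u hu => by
    by_contra h
    exact (hO u).1 hu (hT.mem_subtreeSpan_insert_iff.2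
      ⟨u, Or.inr (Nat.pos_of_ne_zero h), by simp⟩)
  have hchild : ∀ u ∈ O, ∀ c ∈ rootedChildren T v u, c ∈ O := fun u hu c hc => by
    rw [hO] at hu ⊢
    rw [mem_rootedChildren] at hc
    exact fun h => hu (hT.mem_subtreeSpan_of_dist_lt hc.1.symm hc.2 h)
  have hfO : ∀ u, u ∈ O → 0 ≤ f u := rootedChildren_induction T v fun u ih hu => by
    rw [hf u, hωO u hu]
    have := sum_nonneg fun c hc => pebTransfer_nonneg (ih c hc (hchild u hu c hc))
    omega
  have hkO : ∀ u, u ∈ O → rootedHeight T v u ≤ k u :=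
    rootedChildren_induction T v fun u ih hu => by
      rcases Nat.eq_zero_or_pos (rootedHeight T v u) with h | h
      · omega
      · obtain ⟨c, hc, hh⟩ := hT.exists_rootedHeight_add_one_eq h
        have hcO := hchild u hu c hc
        have := ih c hc hcO
        have := (hk u c hc).1 (hfO c hcO)
        omega
  set e : V → ℕ := fun u => if u ∈ O then rootedHeight T v u else k u with he
  have hev : e v = 0 := by simp [he, hvO, hkv]
  obtain ⟨p, hp⟩ := hT.exists_parent v
  have hbr : ∀ c, c ≠ v → -(if 0 ≤ f c then (2 : ℤ) ^ e c else 0) ≤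
      2 ^ e (p c) * pebTransfer (f c) - 2 ^ e c * f c := by
    intro c hc
    have hpc := hp c hc
    have hkc := hk _ c hpc
    split_ifs with h
    · have hle : e c + 1 ≤ e (p c) := by
        simp only [he]
        have h1 := hkc.1 h
        have h2 := hT.rootedHeight_add_one_le hpc
        split_ifs with hcO hpO hpO
        · exact h2
        · have := hkO c hcO
          omega
        · exact absurd (hchild _ hpO _ hpc) hcO
        · omega
      have hpow : (2 : ℤ) ^ (e c + 1) ≤ 2 ^ e (p c) := pow_le_pow_right₀ (by norm_num) hle
      have hg : f c - 1 ≤ 2 * pebTransfer (f c) := by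
        unfold pebTransfer
        grind
      have hg0 := pebTransfer_nonneg h
      have h3 := mul_le_mul_of_nonneg_right hpow hg0
      have h4 := mul_le_mul_of_nonneg_left hg (pow_nonneg (by norm_num : (0 : ℤ) ≤ 2) (e c))
      rw [pow_succ] at h3
      linarith
    · have hcO : c ∉ O := fun hc => h (hfO c hc)
      have hpO : p c ∉ O := fun hpO => hcO (hchild _ hpO _ hpc)
      have heq : e c = e (p c) + 1 := by
        simp only [he, if_neg hcO, if_neg hpO]
        exact hkc.2 h
      have hg : pebTransfer (f c) = 2 * f c := by
        unfold pebTransfer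
        grind
      rw [heq, hg, pow_succ]
      linarith
  have hsum : ∑ u, (2 : ℤ) ^ e u * f u = ∑ u, (2 : ℤ) ^ e u * ((D u : ℤ) - ω u) +
      ∑ c ∈ univ.erase v, (2 : ℤ) ^ e (p c) * pebTransfer (f c) := by
    rw [← hT.sum_rootedChildren hp fun u c => (2 : ℤ) ^ e u * pebTransfer (f c),
      ← sum_add_distrib]
    refine sum_congr rfl fun u _ => ?_
    rw [hf u, mul_add, mul_sum]
  have hmain : ∑ u, (2 : ℤ) ^ e u * (D u : ℤ) <
      ∑ u, (2 : ℤ) ^ e u * (ω u : ℤ) + ∑ c ∈ univ.erase v, if 0 ≤ f c then 2 ^ e c else 0 := by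
    have h1 := sum_le_sum fun c (hc : c ∈ univ.erase v) => hbr c (ne_of_mem_erase hc)
    rw [sum_neg_distrib, sum_sub_distrib] at h1
    rw [← add_sum_erase _ _ (mem_univ v), hev] at hsum
    simp only [mul_sub, sum_sub_distrib] at hsum
    linarith
  have hD' : ∑ u, (D u : ℤ) ≤ ∑ u, (2 : ℤ) ^ e u * (D u : ℤ) := by
    refine sum_le_sum fun u _ => le_mul_of_one_le_left (by positivity) ?_
    exact one_le_pow₀ (by norm_num)
  have hω : ∑ u, (2 : ℤ) ^ e u * (ω u : ℤ) = ∑ u, (2 : ℤ) ^ k u * (ω u : ℤ) := by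
    refine sum_congr rfl fun u _ => ?_
    by_cases hu : u ∈ O
    · simp [hωO u hu]
    · simp [he, hu]
  set A := univ.filter fun c => c ≠ v ∧ c ∉ O ∧ 0 ≤ f c with hA
  have hsplit : (∑ c ∈ univ.erase v, if 0 ≤ f c then 2 ^ e c else 0 : ℤ) =
      ∑ c ∈ A, 2 ^ k c + ∑ c ∈ O, 2 ^ rootedHeight T v c := by
    rw [← sum_filter]
    have h1 : (univ.erase v).filter (fun c => 0 ≤ f c) = A ∪ O := by
      ext c
      simp only [hA, mem_filter, mem_erase, mem_univ, and_true, true_and, mem_union]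
      constructor
      · rintro ⟨h1, h2⟩
        by_cases hc : c ∈ O
        · exact Or.inr hc
        · exact Or.inl ⟨h1, hc, h2⟩
      · rintro (⟨h1, -, h2⟩ | hc)
        · exact ⟨h1, h2⟩
        · exact ⟨fun h => hvO (h ▸ hc), hfO c hc⟩
    rw [h1, sum_union]
    · refine congrArg₂ _ (sum_congr rfl fun c hc => ?_) (sum_congr rfl fun c hc => ?_)
      · simp only [hA, mem_filter] at hc
        simp [he, hc.2.2.1]
      · simp [he, hc]
    · rw [Finset.disjoint_left]
      intro c hc
      simp only [hA, mem_filter] at hc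
      exact hc.2.2.1
  have hcore : ∑ c ∈ A, 2 ^ k c + ∑ u, 2 ^ k u * ω u ≤ ∑ u, ω u * 2 ^ T.dist v u := by
    have h1 : ∑ c ∈ A, 2 ^ k c ≤ ∑ u, ω u *
        ∑ c with c ≠ v ∧ 0 ≤ f c ∧ T.dist v u = T.dist v c + T.dist c u, 2 ^ k c := by
      simp only [sum_filter, mul_sum]
      rw [sum_comm, hA, sum_filter]
      refine sum_le_sum fun c _ => ?_
      split_ifs with hc
      · have hcC := not_not.1 (fun h => hc.2.1 ((hO c).2 h))
        obtain ⟨w, hw, hd⟩ := hT.mem_subtreeSpan_insert_iff.1 hcC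
        have hw0 : 0 < ω w := by
          rcases hw with rfl | hw
          · rw [dist_self] at hd
            exact absurd (hT.connected.dist_eq_zero_iff.1
              (by omega : T.dist w c = 0)).symm hc.1
          · exact hw
        refine le_trans ?_ (single_le_sum (fun _ _ => Nat.zero_le _) (mem_univ w))
        rw [if_pos ⟨hc.1, hc.2.2, hd⟩]
        exact Nat.le_mul_of_pos_left _ hw0
      · exact Nat.zero_le _
    refine (Nat.add_le_add_right h1 _).trans ?_
    rw [← sum_add_distrib]
    refine sum_le_sum fun u _ => ?_
    rw [mul_comm (2 ^ k u), ← mul_add]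
    refine Nat.mul_le_mul_left _ ?_
    convert hT.sum_two_pow_le hkv hk u
  rw [hω, hsplit] at hmain
  zify at hcore ⊢
  linarith

end SimpleGraph.IsTree

lemma exists_le_sum_eq [Fintype V] (D : V → ℕ) {N : ℕ} (h : N ≤ ∑ u, D u) :
    ∃ D' ≤ D, ∑ u, D' u = N := by
  induction h using Nat.decreasingInduction with
  | self => exact ⟨D, le_rfl, rfl⟩
  | of_succ N _ ih =>
    obtain ⟨D', hle, hsum⟩ := ih
    obtain ⟨a, -, ha⟩ := exists_ne_zero_of_sum_ne_zero (s := univ) (f := D') (by omega)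
    refine ⟨Function.update D' a (D' a - 1), fun u => ?_, ?_⟩
    · rcases eq_or_ne u a with rfl | hu
      · rw [Function.update_self]
        exact (Nat.sub_le _ _).trans (hle u)
      · rw [Function.update_of_ne hu]
        exact hle u
    · rw [sum_update_of_mem (mem_univ a)]
      rw [← add_sum_erase _ _ (mem_univ a)] at hsum
      rw [← erase_eq]
      omega

open Classical in
/-- The total demand at the descendants of `u`, measured in pebbles at `u`. -/
noncomputable def branchDemand [Fintype V] (T : SimpleGraph V) (ω : V → ℕ) (v u : V) : ℕ :=
  ∑ w with T.dist v w = T.dist v u + T.dist u w, ω w * 2 ^ T.dist u w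

namespace SimpleGraph.IsTree

variable [Fintype V] {T : SimpleGraph V} (hT : T.IsTree)
include hT

lemma branchDemand_le (ω : V → ℕ) (v u : V) :
    branchDemand T ω v u ≤ ω u + ∑ c ∈ rootedChildren T v u, 2 * branchDemand T ω v c := by
  classical
  simp only [branchDemand, mul_sum, sum_filter]
  rw [sum_comm]
  have h : ω u = ∑ w, if w = u then ω u else 0 := by simp
  rw [h]
  rw [← sum_add_distrib]
  refine sum_le_sum fun w _ => ?_
  split_ifs with h1 h2 h2
  · subst h2
    simp
  · obtain ⟨c, hc, hd, hd'⟩ := hT.exists_mem_rootedChildren_dist h2 h1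
    rw [zero_add]
    refine le_trans ?_ (single_le_sum (fun _ _ => Nat.zero_le _) hc)
    rw [if_pos hd, hd', pow_succ]
    exact le_of_eq (by ring)
  · exact Nat.zero_le _
  · exact Nat.zero_le _

lemma exists_not_solvable {ω : V → ℕ} (hW : ∃ w, 0 < ω w) {v : V} {O : Finset V}
    (hO : ∀ u, u ∈ O ↔ u ∉ subtreeSpan T (insert v {w | 0 < ω w})) {N : ℕ}
    (hN : N < ∑ u, ω u * 2 ^ T.dist v u + ∑ u ∈ O, 2 ^ rootedHeight T v u) :
    ∃ D : V → ℕ, ∑ u, D u = N ∧ ¬ Solvable T ω D := by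
  have hvO : v ∉ O := fun h => (hO v).1 h (hT.mem_subtreeSpan_insert_iff.2 ⟨v, by simp, by simp⟩)
  have hωO : ∀ u ∈ O, ∀ w, T.dist v w = T.dist v u + T.dist u w → ω w = 0 := fun u hu w hw => by
    by_contra h
    exact (hO u).1 hu (hT.mem_subtreeSpan_insert_iff.2
      ⟨w, Or.inr (Nat.pos_of_ne_zero h), hw⟩)
  have hchild : ∀ u ∈ O, ∀ c ∈ rootedChildren T v u, c ∈ O := fun u hu c hc => by
    rw [hO] at hu ⊢
    rw [mem_rootedChildren] at hc
    exact fun h => hu (hT.mem_subtreeSpan_of_dist_lt hc.1.symm hc.2 h)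
  have hne : ∀ u, ∀ c ∈ rootedChildren T v u, c ≠ v := by
    rintro u c hc rfl
    rw [mem_rootedChildren] at hc
    simp at hc
  obtain ⟨p, hp⟩ := hT.exists_parent v
  have hpc : ∀ u, ∀ c ∈ rootedChildren T v u, p c = u := fun u c hc =>
    hT.eq_of_mem_rootedChildren (hp c (hne u c hc)) hc
  have hheavy : ∀ u, ∃ c, 0 < rootedHeight T v u →
      c ∈ rootedChildren T v u ∧ rootedHeight T v c + 1 = rootedHeight T v u := by
    intro u
    by_cases h : 0 < rootedHeight T v u
    · obtain ⟨c, hc⟩ := hT.exists_rootedHeight_add_one_eq h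
      exact ⟨c, fun _ => hc⟩
    · exact ⟨u, fun h' => absurd h' h⟩
  choose hc hhc using hheavy
  obtain ⟨x, hx'⟩ := exists_recursive (T.dist v) fun (c : V) (rec : V → ℕ) =>
    if p c ∈ O ∧ c = hc (p c) then 2 * rec (p c) + 1 else 1
  have hx : ∀ c, c ≠ v → x c = if p c ∈ O ∧ c = hc (p c) then 2 * x (p c) + 1 else 1 := by
    intro c hcv
    rw [hx']
    beta_reduce
    rw [if_pos (mem_rootedChildren.1 (hp c hcv)).2]
  set D : V → ℕ := fun u => if u = v then ∑ w, ω w * 2 ^ T.dist v w - 1 else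
    if u ∈ O ∧ rootedHeight T v u = 0 then x u else 0 with hD
  have hbv : branchDemand T ω v v = ∑ w, ω w * 2 ^ T.dist v w := by
    simp [branchDemand]
  have hpos : 0 < ∑ w, ω w * 2 ^ T.dist v w := by
    obtain ⟨w, hw⟩ := hW
    exact sum_pos' (fun _ _ => Nat.zero_le _) ⟨w, mem_univ w, by positivity⟩
  have hsumx : ∑ u ∈ O with rootedHeight T v u = 0, x u = ∑ u ∈ O, 2 ^ rootedHeight T v u := by
    have h1 : ∑ u ∈ O, 2 ^ rootedHeight T v u * x u =
        ∑ u ∈ O with rootedHeight T v u = 0, x u +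
          ∑ u ∈ O with ¬ rootedHeight T v u = 0, 2 ^ rootedHeight T v u * x u := by
      rw [← sum_filter_add_sum_filter_not O (fun u => rootedHeight T v u = 0)]
      refine congrArg₂ _ (sum_congr rfl fun u hu => ?_) rfl
      rw [(mem_filter.1 hu).2, pow_zero, one_mul]
    have h2 : ∑ u ∈ O, 2 ^ rootedHeight T v u * x u = ∑ u ∈ O, 2 ^ rootedHeight T v u +
        ∑ c ∈ O with p c ∈ O ∧ c = hc (p c), 2 ^ rootedHeight T v c * (2 * x (p c)) := by
      rw [sum_filter, ← sum_add_distrib]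
      refine sum_congr rfl fun c hcO => ?_
      rw [hx c (fun h => hvO (h ▸ hcO))]
      split_ifs <;> ring
    have h3 : ∑ u ∈ O with ¬ rootedHeight T v u = 0, 2 ^ rootedHeight T v u * x u =
        ∑ c ∈ O with p c ∈ O ∧ c = hc (p c), 2 ^ rootedHeight T v c * (2 * x (p c)) := by
      refine sum_nbij' hc p (fun u hu => ?_) (fun c hcO => ?_) (fun u hu => ?_) (fun c hcO => ?_)
        fun u hu => ?_
      · rw [mem_filter] at hu ⊢
        have h := (hhc u (Nat.pos_of_ne_zero hu.2)).1
        rw [hpc _ _ h]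
        exact ⟨hchild u hu.1 _ h, hu.1, rfl⟩
      · rw [mem_filter] at hcO ⊢
        have := hT.rootedHeight_add_one_le (hp c fun h => hvO (h ▸ hcO.1))
        exact ⟨hcO.2.1, by omega⟩
      · exact hpc _ _ (hhc u (Nat.pos_of_ne_zero (mem_filter.1 hu).2)).1
      · exact (mem_filter.1 hcO).2.2.symm
      · have h := hhc u (Nat.pos_of_ne_zero (mem_filter.1 hu).2)
        rw [hpc _ _ h.1, ← h.2, pow_succ]
        ring
    omega
  have hsumD : ∑ u, D u + 1 =
      ∑ u, ω u * 2 ^ T.dist v u + ∑ u ∈ O, 2 ^ rootedHeight T v u := by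
    rw [← hsumx, ← add_sum_erase _ _ (mem_univ v)]
    have h1 : ∑ u ∈ univ.erase v, D u = ∑ u ∈ O with rootedHeight T v u = 0, x u := by
      rw [sum_congr rfl fun u hu => if_neg (ne_of_mem_erase hu), ← sum_filter]
      refine sum_congr ?_ fun _ _ => rfl
      ext u
      simp only [mem_filter, mem_erase, mem_univ, and_true, and_iff_right_iff_imp]
      rintro h rfl
      exact hvO h.1
    have h2 : D v = ∑ w, ω w * 2 ^ T.dist v w - 1 := if_pos rfl
    rw [h1, h2]
    omega
  obtain ⟨D', hle, hsum⟩ := exists_le_sum_eq D (N := N) (by omega)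
  set f : V → ℤ := fun u => if u = v then -1 else if u ∈ O then (x u : ℤ) else
    -(branchDemand T ω v u : ℤ) with hf
  have hfO : ∀ u ∈ O, f u = x u := fun u hu => by
    have huv : u ≠ v := fun h => hvO (h ▸ hu)
    simp only [hf, if_neg huv, if_pos hu]
  refine ⟨D', hsum, hT.not_solvable_of_excess_le v f (fun u => ?_) (by simp [hf])⟩
  have hDu : (D' u : ℤ) ≤ D u := by exact_mod_cast hle u
  by_cases hu : u ∈ O
  · have huv : u ≠ v := fun h => hvO (h ▸ hu)
    rw [hfO u hu, hωO u hu u (by simp)]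
    rcases Nat.eq_zero_or_pos (rootedHeight T v u) with h | h
    · have h1 : rootedChildren T v u = ∅ := by
        refine eq_empty_of_forall_notMem fun c hc => ?_
        have := hT.rootedHeight_add_one_le hc
        omega
      have h2 : D u = x u := by simp only [hD, if_neg huv, if_pos (And.intro hu h)]
      rw [h1, sum_empty]
      omega
    · have h1 := (hhc u h).1
      have h2 : D u = 0 := by
        simp only [hD, if_neg huv]
        exact if_neg fun h' => h.ne' h'.2
      have h3 : ∑ c ∈ rootedChildren T v u, pebTransfer (f c) = x u := by
        rw [sum_eq_single_of_mem _ h1]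
        · rw [hfO _ (hchild u hu _ h1), hx _ (hne _ _ h1), hpc _ _ h1, if_pos ⟨hu, rfl⟩]
          unfold pebTransfer
          grind
        · intro c hcu hcne
          rw [hfO _ (hchild u hu _ hcu), hx _ (hne _ _ hcu), hpc _ _ hcu,
            if_neg fun h => hcne h.2]
          simp [pebTransfer]
      omega
  · have h1 : ∑ c ∈ rootedChildren T v u, pebTransfer (f c) ≤
        ∑ c ∈ rootedChildren T v u, -(2 * (branchDemand T ω v c : ℤ)) := by
      refine sum_le_sum fun c hcu => ?_
      by_cases hcO : c ∈ O
      · have h0 : branchDemand T ω v c = 0 := by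
          refine sum_eq_zero fun w hw => ?_
          rw [hωO c hcO w (by simpa using hw), zero_mul]
        rw [hfO _ hcO, hx _ (hne _ _ hcu), hpc _ _ hcu, if_neg fun h => hu h.1, h0]
        simp [pebTransfer]
      · simp only [hf, if_neg (hne _ _ hcu), if_neg hcO]
        unfold pebTransfer
        grind
    have h2 := hT.branchDemand_le ω v u
    rw [sum_neg_distrib] at h1
    zify at h2
    by_cases huv : u = v
    · subst huv
      have h3 : D u = ∑ w, ω w * 2 ^ T.dist u w - 1 := if_pos rfl
      have h4 : f u = -1 := if_pos rfl
      rw [← hbv] at h3 hpos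
      omega
    · have h3 : D u = 0 := by
        simp only [hD, if_neg huv]
        exact if_neg fun h' => hu h'.1
      have h4 : f u = -(branchDemand T ω v u : ℤ) := by
        simp only [hf, if_neg huv, if_neg hu]
      omega

end SimpleGraph.IsTree

/-- The `ω`-cover pebbling number of a tree with nonnegative weight function `ω`
(of nonempty support) equals `max_v s_ω(v)`, where
`s_ω(v) = Σ_{u∈W} ω(u)·2^{d(u,v)} + Σᵢ (2^{aᵢ} - 1)` with `(aᵢ)` the maximum path
partition sizes of `T⃗ \ E(T_ω(v))`. -/
theorem cover_pebbling_number_tree (T : SimpleGraph V) [Fintype V] (hT : T.IsTree)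
    (ω : V → ℕ) (hW : ∃ w, 0 < ω w) (s : V → ℕ)
    (hs : ∀ x : V, ∃ P : PathSys T, IsMaxPartitionTo T (phiOmega T ω x) P ∧
      s x = (∑ u, ω u * 2 ^ T.dist u x) + pathsExtra P) :
    coverNum T ω = Finset.univ.sup s := by
  classical
  have hO : ∀ v, ∃ O : Finset V, (∀ u, u ∈ O ↔ u ∉ subtreeSpan T (insert v {w | 0 < ω w})) ∧
      s v = ∑ u, ω u * 2 ^ T.dist v u + ∑ u ∈ O, 2 ^ rootedHeight T v u := by
    intro v
    obtain ⟨P, hP, hsv⟩ := hs v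
    have h : ∀ u, u ∈ univ.filter (fun u => u ∉ subtreeSpan T (insert v {w | 0 < ω w})) ↔
        u ∉ subtreeSpan T (insert v {w | 0 < ω w}) := by simp
    refine ⟨_, h, ?_⟩
    rw [hsv, hT.pathsExtra_eq_sum hP h]
    simp only [SimpleGraph.dist_comm (v := v)]
  refine le_antisymm (Nat.sInf_le fun D hD => ?_) (le_csInf ⟨univ.sup s, fun D hD => ?_⟩ ?_)
  · by_contra hsol
    obtain ⟨v, hv⟩ := hT.sum_lt_of_not_solvable hsol
    obtain ⟨O, hO, hsv⟩ := hO v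
    have h1 := hv O hO
    have h2 := le_sup (f := s) (mem_univ v)
    omega
  · by_contra hsol
    obtain ⟨v, hv⟩ := hT.sum_lt_of_not_solvable hsol
    obtain ⟨O, hO, hsv⟩ := hO v
    have h1 := hv O hO
    have h2 := le_sup (f := s) (mem_univ v)
    omega
  · intro N hN
    refine Finset.sup_le fun v _ => ?_
    by_contra hlt
    obtain ⟨O, hO, hsv⟩ := hO v
    obtain ⟨D, hD, hsol⟩ := hT.exists_not_solvable hW hO (N := N) (by omega)
    exact hsol (hN D hD)
end

section
/- Let G and H be connected graphs, ω₁ a positive integer weight function on V(G) and ω₂ a positive integer weight function on V(H), and define ω on the Cartesian product G □ H by ω((g,h)) = ω₁(g)·ω₂(h). Then γ_ω(G □ H) = γ_{ω₁}(G)·γ_{ω₂}(H). -/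
open SimpleGraph Finset

variable {V : Type*} [DecidableEq V]

/-- The distribution obtained from `D` by a pebbling move from `u` to `v`. -/
def pebMove (D : V → ℕ) (u v : V) : V → ℕ :=
  fun x => if x = u then D u - 2 else if x = v then D v + 1 else D x

lemma pebMove_left (D : V → ℕ) (u v : V) : pebMove D u v u = D u - 2 := by
  simp [pebMove]

lemma pebMove_right (D : V → ℕ) {u v : V} (h : u ≠ v) : pebMove D u v v = D v + 1 := by
  simp [pebMove, h.symm]

lemma pebMove_of_ne (D : V → ℕ) {u v x : V} (hu : x ≠ u) (hv : x ≠ v) :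
    pebMove D u v x = D x := by
  simp [pebMove, hu, hv]

lemma sum_pebMove_mul [Fintype V] {D : V → ℕ} {u v : V} (huv : u ≠ v) (hD : 2 ≤ D u)
    (c : V → ℕ) :
    ∑ x, pebMove D u v x * c x + 2 * c u = ∑ x, D x * c x + c v := by
  have key : ∀ x, pebMove D u v x * c x + (if x = u then 2 * c u else 0) =
      D x * c x + (if x = v then c v else 0) := by
    intro x
    by_cases hxu : x = u
    · subst hxu
      rw [pebMove_left, if_pos rfl, if_neg huv, ← add_mul, Nat.sub_add_cancel hD, add_zero]
    · by_cases hxv : x = v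
      · subst hxv
        rw [pebMove_right D huv, if_neg hxu, if_pos rfl]
        ring
      · rw [pebMove_of_ne D hxu hxv, if_neg hxu, if_neg hxv]
  have := Finset.sum_congr (rfl : (univ : Finset V) = univ) fun x _ => key x
  simpa [Finset.sum_add_distrib] using this

/-- A weight that at most doubles along edges is not increased by pebbling moves. -/
lemma PebReach.sum_mul_le [Fintype V] {G : SimpleGraph V} {c : V → ℕ}
    (hc : ∀ x y, G.Adj x y → c y ≤ 2 * c x) {D D' : V → ℕ} (h : PebReach G D D') :
    ∑ x, D' x * c x ≤ ∑ x, D x * c x := by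
  induction h with
  | refl => exact le_rfl
  | @tail E E' _ hs ih =>
    obtain ⟨u, v, huv, hE, rfl⟩ := hs
    have h := sum_pebMove_mul huv.ne hE c
    have := hc u v huv
    change ∑ x, pebMove E u v x * c x ≤ _
    omega

omit [DecidableEq V] in
lemma le_two_pow_length_mul {G : SimpleGraph V} {c : V → ℕ}
    (hc : ∀ x y, G.Adj x y → c y ≤ 2 * c x) {u v : V} (p : G.Walk u v) :
    c v ≤ 2 ^ p.length * c u := by
  induction p with
  | nil => simp
  | @cons u w v h q ih =>
    rw [Walk.length_cons, pow_succ, mul_assoc]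
    exact ih.trans (Nat.mul_le_mul_left _ (hc u w h))

/-- Relaying a pebble along a path whose inner vertices are occupied; if the weight `c` doubles
at each step of the path, no weight is lost. -/
lemma exists_pebReach_of_isPath [Fintype V] {G : SimpleGraph V} {c : V → ℕ}
    (hc : ∀ x y, G.Adj x y → c y ≤ 2 * c x) {f t : V} (p : G.Walk f t) (hp : p.IsPath)
    (hlen : 0 < p.length) (hct : 2 ^ p.length * c f ≤ c t) (D : V → ℕ) (hf : 2 ≤ D f)
    (hD : ∀ x ∈ p.support, x ≠ f → x ≠ t → 1 ≤ D x) :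
    ∃ D', PebReach G D D' ∧ (∀ x, x ≠ t → D' x ≤ D x) ∧ D' f + 2 ≤ D f ∧ D' t = D t + 1 ∧
      ∑ x, D' x < ∑ x, D x ∧ ∑ x, D x * c x ≤ ∑ x, D' x * c x := by
  induction p generalizing D with
  | nil => simp at hlen
  | @cons f v t h q ih =>
    rw [Walk.cons_isPath_iff] at hp
    obtain ⟨hq, hfq⟩ := hp
    have hft : f ≠ t := fun e => hfq (e ▸ q.end_mem_support)
    rw [Walk.length_cons, pow_succ, mul_assoc] at hct
    have hcv : 2 * c f ≤ c v :=
      Nat.le_of_mul_le_mul_left (hct.trans (le_two_pow_length_mul hc q)) (by positivity)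
    have hstep : PebStep G D (pebMove D f v) := ⟨f, v, h, hf, rfl⟩
    have hsum : ∑ x, pebMove D f v x + 2 = ∑ x, D x + 1 := by
      simpa using sum_pebMove_mul h.ne hf fun _ => 1
    have hsumc := sum_pebMove_mul h.ne hf c
    have hDf := pebMove_left D f v
    have hDv := pebMove_right D h.ne
    rcases Nat.eq_zero_or_pos q.length with hq0 | hq0
    · obtain rfl := Walk.eq_of_length_eq_zero hq0
      refine ⟨pebMove D f v, .single hstep, fun x hx => ?_, by omega, hDv, by omega, by omega⟩
      by_cases hxf : x = f
      · subst hxf; omega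
      · exact (pebMove_of_ne D hxf hx).le
    · have hvt : v ≠ t := by
        rintro rfl
        rw [Walk.isPath_iff_nil, ← Walk.length_eq_zero_iff] at hq
        omega
      have hvD := hD v (by simp) h.ne.symm hvt
      obtain ⟨D', hr, hle, hv, ht, hs, hsc⟩ := ih hq hq0
        (le_trans (Nat.mul_le_mul_left _ (hc f v h)) hct) (pebMove D f v) (by omega) (by
          intro x hx hxv hxt
          have hxf : x ≠ f := fun e => hfq (e ▸ hx)
          rw [pebMove_of_ne D hxf hxv]
          exact hD x (by simp [hx]) hxf hxt)
      refine ⟨D', .head hstep hr, fun x hx => ?_, ?_, ?_, by omega, by omega⟩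
      · have := hle x hx
        by_cases hxf : x = f
        · subst hxf; omega
        · by_cases hxv : x = v
          · subst hxv; omega
          · rwa [pebMove_of_ne D hxf hxv] at this
      · have := hle f hft
        omega
      · rw [ht, pebMove_of_ne D hft.symm hvt.symm]

omit [DecidableEq V] in
lemma two_pow_dist_le_of_adj {G : SimpleGraph V} (hG : G.Connected) (v : V) {x y : V}
    (h : G.Adj x y) : 2 ^ G.dist y v ≤ 2 * 2 ^ G.dist x v := by
  rw [← pow_succ']
  refine Nat.pow_le_pow_right two_pos ?_
  have := hG.dist_triangle (u := y) (v := x) (w := v)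
  have := dist_eq_one_iff_adj.2 h.symm
  omega

/-- Solvability from a weighted count, where the weight is bounded by `2 ^ dist · s` for some
vertex `s` and for every vertex `s` with a surplus of pebbles. -/
lemma solvable_of_le_sum_mul [Fintype V] {G : SimpleGraph V} (hG : G.Connected) {ω : V → ℕ}
    (hω : ∀ v, 0 < ω v) {N : ℕ} (hN : ∀ v, ∑ u, ω u * 2 ^ G.dist u v ≤ N) (D c : V → ℕ) (s : V)
    (hs : ∀ u, c u ≤ 2 ^ G.dist u s) (hfat : ∀ f, ω f < D f → ∀ u, c u ≤ 2 ^ G.dist u f)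
    (hD : N ≤ ∑ u, D u * c u) : Solvable G ω D := by
  induction hn : ∑ u, D u using Nat.strong_induction_on generalizing D c s with
  | _ n ih =>
  subst hn
  by_cases hthin : ∀ v, ω v ≤ D v
  · exact ⟨D, .refl, hthin⟩
  push Not at hthin
  obtain ⟨t₀, ht₀⟩ := hthin
  let F : Finset V := {f | ω f < D f}
  let T : Finset V := {t | D t < ω t}
  have hT : T.Nonempty := ⟨t₀, by simpa [T] using ht₀⟩
  by_cases hF : F.Nonempty
  · obtain ⟨⟨f, t⟩, hft, hmin⟩ :=
      (F ×ˢ T).exists_min_image (fun q => G.dist q.1 q.2) (hF.product hT)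
    obtain ⟨hfF, htT⟩ := Finset.mem_product.1 hft
    have hf : ω f < D f := by simpa [F] using hfF
    have ht : D t < ω t := by simpa [T] using htT
    have hmin' : ∀ f' t', ω f' < D f' → D t' < ω t' → G.dist f t ≤ G.dist f' t' :=
      fun f' t' hf' ht' => hmin (f', t') (by simp [F, T, hf', ht'])
    have hne : f ≠ t := by rintro rfl; omega
    obtain ⟨p, hp, hlen⟩ := hG.exists_path_of_dist f t
    let c' : V → ℕ := fun u => F.inf' hF fun f => 2 ^ G.dist u f
    have hc'F : ∀ f', ω f' < D f' → ∀ u, c' u ≤ 2 ^ G.dist u f' :=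
      fun f' hf' u => Finset.inf'_le _ (by simpa [F] using hf')
    have hcc' : ∀ u, c u ≤ c' u := fun u =>
      Finset.le_inf' _ _ fun f' hf' => hfat f' (by simpa [F] using hf') u
    have hc' : ∀ x y, G.Adj x y → c' y ≤ 2 * c' x := by
      intro x y hxy
      obtain ⟨f', hf', he⟩ := F.exists_mem_eq_inf' hF fun f => 2 ^ G.dist x f
      change _ ≤ 2 * F.inf' hF _
      rw [he]
      exact (Finset.inf'_le _ hf').trans (two_pow_dist_le_of_adj hG f' hxy)
    have hct : 2 ^ p.length * c' f ≤ c' t := by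
      have h1 : c' f ≤ 1 := by simpa using hc'F f hf f
      refine (Nat.mul_le_mul_left _ h1).trans ?_
      rw [mul_one]
      refine Finset.le_inf' _ _ fun f' hf' => Nat.pow_le_pow_right two_pos ?_
      rw [hlen, dist_comm (u := t)]
      exact hmin' f' t (by simpa [F] using hf') ht
    have hinner : ∀ x ∈ p.support, x ≠ f → x ≠ t → 1 ≤ D x := by
      intro x hx hxf hxt
      have hadd := congrArg Walk.length (p.take_spec hx)
      rw [Walk.length_append] at hadd
      have h1 : (p.takeUntil x hx).length ≠ 0 := fun h => hxf (Walk.eq_of_length_eq_zero h).symm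
      have := dist_le (p.takeUntil x hx)
      by_contra h
      have := hmin' f x hf (by have := hω x; omega)
      have h2 : (p.dropUntil x hx).length ≠ 0 := fun h => hxt (Walk.eq_of_length_eq_zero h)
      omega
    have hlen0 : 0 < p.length := hlen ▸ hG.pos_dist_of_ne hne
    obtain ⟨D', hr, hle, -, hD't, hlt, hsum⟩ := exists_pebReach_of_isPath hc' p hp hlen0 hct D
      (by have := hω f; omega) hinner
    have hfat' : ∀ x, ω x < D' x → ω x < D x := by
      intro x hx
      by_cases hxt : x = t
      · subst hxt; omega
      · exact hx.trans_le (hle x hxt)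
    obtain ⟨E, hE, hωE⟩ := ih _ hlt D' c' f (hc'F f hf) (fun x hx => hc'F x (hfat' x hx))
      (hD.trans <| (Finset.sum_le_sum fun u _ => Nat.mul_le_mul_left _ (hcc' u)).trans hsum) rfl
    exact ⟨E, hr.trans hE, hωE⟩
  · have hle : ∀ u, D u ≤ ω u := by
      intro u
      by_contra h
      exact hF ⟨u, by simpa [F] using h⟩
    have : ∑ u, D u * c u < ∑ u, ω u * 2 ^ G.dist u s :=
      Finset.sum_lt_sum (fun u _ => Nat.mul_le_mul (hle u) (hs u))
        ⟨t₀, mem_univ _, (Nat.mul_le_mul_left _ (hs t₀)).trans_lt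
          (Nat.mul_lt_mul_of_pos_right ht₀ (by positivity))⟩
    have := hN s
    omega

/-- The cover pebbling theorem: the worst distributions are concentrated on one vertex. -/
theorem coverNum_eq_sup [Fintype V] {G : SimpleGraph V} (hG : G.Connected) {ω : V → ℕ}
    (hω : ∀ v, 0 < ω v) :
    coverNum G ω = univ.sup fun v => ∑ u, ω u * 2 ^ G.dist u v := by
  have hmem : (univ.sup fun v => ∑ u, ω u * 2 ^ G.dist u v) ∈
      {N | ∀ D : V → ℕ, (∑ v, D v) = N → Solvable G ω D} := by
    intro D hD
    obtain ⟨s⟩ := hG.nonempty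
    refine solvable_of_le_sum_mul hG hω (fun v => ?_) D (fun _ => 1) s
      (fun u => Nat.one_le_two_pow) (fun f _ u => Nat.one_le_two_pow) (N := ∑ v, D v) (by simp)
    rw [hD]
    exact Finset.le_sup (f := fun v => ∑ u, ω u * 2 ^ G.dist u v) (mem_univ v)
  refine le_antisymm (Nat.sInf_le hmem) (le_csInf ⟨_, hmem⟩ fun N hN => Finset.sup_le fun v _ => ?_)
  obtain ⟨D', hr, hD'⟩ := hN (Pi.single v N) (by simp)
  calc ∑ u, ω u * 2 ^ G.dist u v ≤ ∑ u, D' u * 2 ^ G.dist u v :=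
        Finset.sum_le_sum fun u _ => Nat.mul_le_mul_right _ (hD' u)
    _ ≤ ∑ u, (Pi.single v N : V → ℕ) u * 2 ^ G.dist u v :=
        hr.sum_mul_le (c := fun u => 2 ^ G.dist u v) fun x y h => two_pow_dist_le_of_adj hG v h
    _ = N := by simp [Pi.single_apply]

lemma dist_boxProd_of_connected {V W : Type*} {G : SimpleGraph V} {H : SimpleGraph W}
    (hG : G.Connected) (hH : H.Connected) (x y : V × W) :
    (G.boxProd H).dist x y = G.dist x.1 y.1 + H.dist x.2 y.2 := by
  have h := edist_boxProd (G := G) (H := H) x y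
  rw [← ((hG.boxProd hH).preconnected x y).coe_dist_eq_edist,
    ← (hG.preconnected _ _).coe_dist_eq_edist, ← (hH.preconnected _ _).coe_dist_eq_edist] at h
  exact_mod_cast h

/-- Multiplicativity of the cover pebbling number for the Cartesian (box) product
with positive product weight function. -/
theorem cover_pebbling_box_product {W : Type*} [DecidableEq W] [Fintype V] [Fintype W]
    (G : SimpleGraph V) (H : SimpleGraph W) (hG : G.Connected) (hH : H.Connected)
    (ω₁ : V → ℕ) (ω₂ : W → ℕ) (h₁ : ∀ v, 0 < ω₁ v) (h₂ : ∀ w, 0 < ω₂ w) :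
    coverNum (G.boxProd H) (fun p => ω₁ p.1 * ω₂ p.2) =
      coverNum G ω₁ * coverNum H ω₂ := by
  rw [coverNum_eq_sup (hG.boxProd hH) fun p => Nat.mul_pos (h₁ p.1) (h₂ p.2),
    coverNum_eq_sup hG h₁, coverNum_eq_sup hH h₂]
  have hprod : ∀ q : V × W, ∑ p : V × W, ω₁ p.1 * ω₂ p.2 * 2 ^ (G.boxProd H).dist p q =
      (∑ u, ω₁ u * 2 ^ G.dist u q.1) * ∑ w, ω₂ w * 2 ^ H.dist w q.2 := by
    intro q
    rw [Finset.sum_mul_sum, Fintype.sum_prod_type]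
    refine Finset.sum_congr rfl fun u _ => Finset.sum_congr rfl fun w _ => ?_
    rw [dist_boxProd_of_connected hG hH, pow_add, mul_mul_mul_comm]
  simp only [hprod]
  have := hG.nonempty
  have := hH.nonempty
  apply le_antisymm
  · exact Finset.sup_le fun q _ => Nat.mul_le_mul
      (Finset.le_sup (f := fun v => ∑ u, ω₁ u * 2 ^ G.dist u v) (mem_univ q.1))
      (Finset.le_sup (f := fun v => ∑ u, ω₂ u * 2 ^ H.dist u v) (mem_univ q.2))
  · obtain ⟨v, -, hv⟩ := Finset.exists_mem_eq_sup univ univ_nonempty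
      fun v => ∑ u, ω₁ u * 2 ^ G.dist u v
    obtain ⟨w, -, hw⟩ := Finset.exists_mem_eq_sup univ univ_nonempty
      fun w => ∑ u, ω₂ u * 2 ^ H.dist u w
    rw [hv, hw]
    exact Finset.le_sup_of_le (mem_univ (v, w)) le_rfl
end

section
/- Let T be a tree and ω a nonnegative weight function on V(T) whose support W is a single vertex v with ω(v) = t ≥ 1. Then f_t(T, v) = s_ω(T), where s_ω(T) = max over x ∈ V(T) of [ t·2^{d(v,x)} + Σ_{i=1}^n (2^{a_i} − 1) ], with (a_1,...,a_n) the path lengths of the maximum path partition of T with the edges of the v–x path removed and the remaining edges directed toward that path. -/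
open SimpleGraph Finset

variable {V : Type*} [DecidableEq V]

namespace TreePebbling

variable {U : Type*}

/-- The neighbour of `u` that is closer to the root `v`; junk at the root itself. -/
noncomputable def parent (T : SimpleGraph U) (v u : U) : U :=
  open Classical in if h : ∃ w, T.Adj u w ∧ T.dist v w + 1 = T.dist v u then h.choose else u

/-- The length of a longest descending path from `u` when the tree is rooted at `v`. -/
noncomputable def height [Fintype U] (T : SimpleGraph U) (v u : U) : ℕ :=
  univ.sup fun w => if T.dist v w = T.dist v u + T.dist u w then T.dist u w else 0

/-- A child of `u` of maximal height; junk if `u` is a leaf. -/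
noncomputable def heavyChild [Fintype U] (T : SimpleGraph U) (v u : U) : U :=
  open Classical in
  if h : ∃ c, c ≠ v ∧ parent T v c = u ∧ height T v c + 1 = height T v u then h.choose else u

section Rooted

variable {T : SimpleGraph U}

theorem exists_adj_dist_add_one (hT : T.Connected) {u w : U} (h : u ≠ w) :
    ∃ c, T.Adj u c ∧ T.dist c w + 1 = T.dist u w := by
  obtain ⟨p, hp⟩ := hT.exists_walk_length_eq_dist u w
  cases p with
  | nil => exact absurd rfl h
  | cons hadj q =>
    rename_i c
    refine ⟨c, hadj, ?_⟩
    have h1 := dist_le q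
    have h2 := hT.dist_triangle (u := u) (v := c) (w := w)
    have h3 := dist_eq_one_iff_adj.2 hadj
    simp only [Walk.length_cons] at hp
    omega

theorem parent_spec (hT : T.IsTree) {v u : U} (h : u ≠ v) :
    T.Adj u (parent T v u) ∧ T.dist v (parent T v u) + 1 = T.dist v u := by
  have hex : ∃ w, T.Adj u w ∧ T.dist v w + 1 = T.dist v u := by
    obtain ⟨c, hc, hd⟩ := exists_adj_dist_add_one hT.connected h
    exact ⟨c, hc, by rwa [T.dist_comm, T.dist_comm (u := v)]⟩
  rw [parent, dif_pos hex]
  exact hex.choose_spec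

theorem eq_parent (hT : T.IsTree) {v u w : U} (hadj : T.Adj u w)
    (hd : T.dist v w + 1 = T.dist v u) : w = parent T v u := by
  have hu : u ≠ v := by
    rintro rfl
    simp at hd
  have key : ∀ z, T.Adj u z → T.dist v z + 1 = T.dist v u →
      ∃ p : T.Walk v u, p.IsPath ∧ p.penultimate = z := by
    intro z hz hdz
    obtain ⟨p, hp⟩ := hT.connected.exists_walk_length_eq_dist v z
    refine ⟨p.concat hz.symm, ?_, by simp⟩
    exact Walk.isPath_of_length_eq_dist _ (by simp [hp, hdz])
  obtain ⟨p, hp, rfl⟩ := key w hadj hd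
  obtain ⟨q, hq, hqe⟩ := key _ (parent_spec hT hu).1 (parent_spec hT hu).2
  rw [← hqe, (hT.existsUnique_path v u).unique hp hq]

theorem adj_cases (hT : T.IsTree) (v : U) {a b : U} (h : T.Adj a b) :
    (a ≠ v ∧ parent T v a = b) ∨ (b ≠ v ∧ parent T v b = a) := by
  rcases hT.dist_eq_dist_add_one_of_adj v h with h1 | h1
  · refine Or.inl ⟨?_, (eq_parent hT h h1.symm).symm⟩
    rintro rfl
    simp at h1
  · refine Or.inr ⟨?_, (eq_parent hT h.symm h1.symm).symm⟩
    rintro rfl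
    simp at h1

variable [Fintype U]

theorem dist_le_height {v u w : U} (h : T.dist v w = T.dist v u + T.dist u w) :
    T.dist u w ≤ height T v u := by
  have := Finset.le_sup (f := fun w => if T.dist v w = T.dist v u + T.dist u w
    then T.dist u w else 0) (mem_univ w)
  simp only [if_pos h] at this
  exact this

theorem exists_dist_eq_height (T : SimpleGraph U) (v u : U) :
    ∃ w, T.dist v w = T.dist v u + T.dist u w ∧ T.dist u w = height T v u := by
  obtain ⟨w, -, hw⟩ := exists_mem_eq_sup univ ⟨u, mem_univ u⟩
    (fun w => if T.dist v w = T.dist v u + T.dist u w then T.dist u w else 0)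
  change height T v u = _ at hw
  split_ifs at hw with h
  · exact ⟨w, h, hw.symm⟩
  · exact ⟨u, by simp, by simp [hw]⟩

theorem height_lt_height_parent (hT : T.IsTree) {v u : U} (h : u ≠ v) :
    height T v u + 1 ≤ height T v (parent T v u) := by
  obtain ⟨hadj, hd⟩ := parent_spec hT h
  obtain ⟨w, hw, hw'⟩ := exists_dist_eq_height T v u
  have h1 := hT.connected.dist_triangle (u := parent T v u) (v := u) (w := w)
  have h2 := hT.connected.dist_triangle (u := v) (v := parent T v u) (w := w)
  have h3 := dist_eq_one_iff_adj.2 hadj.symm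
  have := dist_le_height (T := T) (v := v) (u := parent T v u) (w := w) (by omega)
  omega

theorem heavyChild_spec (hT : T.IsTree) {v u : U} (h : 0 < height T v u) :
    heavyChild T v u ≠ v ∧ parent T v (heavyChild T v u) = u ∧
      height T v (heavyChild T v u) + 1 = height T v u := by
  have hex : ∃ c, c ≠ v ∧ parent T v c = u ∧ height T v c + 1 = height T v u := by
    obtain ⟨w, hw, hw'⟩ := exists_dist_eq_height T v u
    obtain ⟨c, hadj, hc⟩ := exists_adj_dist_add_one hT.connected (u := u) (w := w) (by
      rintro rfl
      simp at hw'
      omega)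
    have h1 := hT.connected.dist_triangle (u := v) (v := c) (w := w)
    have h2 := hT.connected.dist_triangle (u := v) (v := u) (w := c)
    have h3 := dist_eq_one_iff_adj.2 hadj
    have hcu : parent T v c = u := (eq_parent hT hadj.symm (by omega)).symm
    have hcv : c ≠ v := by
      rintro rfl
      simp at h1 hw
      omega
    have h4 := dist_le_height (T := T) (v := v) (u := c) (w := w) (by omega)
    have h5 := height_lt_height_parent hT hcv
    rw [hcu] at h5
    exact ⟨c, hcv, hcu, by omega⟩
  rw [heavyChild, dif_pos hex]
  exact hex.choose_spec

end Rooted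

section Pebbling

variable {T : SimpleGraph V}

/-- `r` bounds, for each `u`, the number of pebbles that can be gathered at `u` from the
distribution `D` within the subtree of descendants of `u`. -/
def IsLoadBound [Fintype V] (T : SimpleGraph V) (v : V) (D r : V → ℕ) : Prop :=
  ∀ u, D u + ∑ c with c ≠ v ∧ parent T v c = u, r c / 2 ≤ r u

variable [Fintype V]

theorem IsLoadBound.step (hT : T.IsTree) {v : V} {D D' r : V → ℕ} (hr : IsLoadBound T v D r)
    (h : PebStep T D D') : ∃ r', IsLoadBound T v D' r' ∧ r' v = r v := by
  obtain ⟨a, b, hadj, h2, rfl⟩ := h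
  have hab := hadj.ne
  rcases adj_cases hT v hadj with ⟨hv, hp⟩ | ⟨hv, hp⟩
  · refine ⟨fun x => if x = a then r a - 2 else r x, fun u => ?_, by simp [hv.symm]⟩
    have hu := hr u
    by_cases hua : u = a
    · subst hua
      have hsum : ∑ c with c ≠ v ∧ parent T v c = u, (if c = u then r u - 2 else r c) / 2
          = ∑ c with c ≠ v ∧ parent T v c = u, r c / 2 := by
        refine sum_congr rfl fun c hc => ?_
        rw [if_neg]
        rintro rfl
        simp only [mem_filter, mem_univ, true_and] at hc
        exact hab (hc.2.symm.trans hp)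
      simp only [if_true, hsum]
      omega
    by_cases hub : u = b
    · subst hub
      have ha : a ∈ ({c | c ≠ v ∧ parent T v c = u} : Finset V) := by simp [hv, hp]
      have hra : 2 ≤ r a := h2.trans ((Nat.le_add_right _ _).trans (hr a))
      rw [← add_sum_erase _ _ ha] at hu ⊢
      have hsum : ∑ c ∈ ({c | c ≠ v ∧ parent T v c = u} : Finset V).erase a,
          (if c = a then r a - 2 else r c) / 2
          = ∑ c ∈ ({c | c ≠ v ∧ parent T v c = u} : Finset V).erase a, r c / 2 := by
        refine sum_congr rfl fun c hc => ?_
        rw [if_neg (ne_of_mem_erase hc)]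
      simp only [if_neg hua, if_true, hsum]
      omega
    · have hsum : ∑ c with c ≠ v ∧ parent T v c = u, (if c = a then r a - 2 else r c) / 2
          = ∑ c with c ≠ v ∧ parent T v c = u, r c / 2 := by
        refine sum_congr rfl fun c hc => ?_
        rw [if_neg]
        rintro rfl
        simp only [mem_filter, mem_univ, true_and] at hc
        exact hub (hc.2.symm.trans hp)
      simpa only [if_neg hua, if_neg hub, hsum] using hu
  · refine ⟨fun x => if x = b then r b + 1 else r x, fun u => ?_, by simp [hv.symm]⟩
    have hu := hr u
    by_cases hua : u = a
    · subst hua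
      have hb : b ∈ ({c | c ≠ v ∧ parent T v c = u} : Finset V) := by simp [hv, hp]
      rw [← add_sum_erase _ _ hb] at hu ⊢
      have hsum : ∑ c ∈ ({c | c ≠ v ∧ parent T v c = u} : Finset V).erase b,
          (if c = b then r b + 1 else r c) / 2
          = ∑ c ∈ ({c | c ≠ v ∧ parent T v c = u} : Finset V).erase b, r c / 2 := by
        refine sum_congr rfl fun c hc => ?_
        rw [if_neg (ne_of_mem_erase hc)]
      simp only [if_neg hab, if_true, hsum]
      omega
    have hsum : ∑ c with c ≠ v ∧ parent T v c = u, (if c = b then r b + 1 else r c) / 2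
        = ∑ c with c ≠ v ∧ parent T v c = u, r c / 2 := by
      refine sum_congr rfl fun c hc => ?_
      rw [if_neg]
      rintro rfl
      simp only [mem_filter, mem_univ, true_and] at hc
      exact hua (hc.2.symm.trans hp)
    by_cases hub : u = b
    · subst hub
      simp only [if_neg hua, if_true, hsum]
      omega
    · simpa only [if_neg hua, if_neg hub, hsum] using hu

theorem IsLoadBound.apply_root_le (hT : T.IsTree) {v : V} {D D' r : V → ℕ}
    (hr : IsLoadBound T v D r) (h : PebReach T D D') : D' v ≤ r v := by
  induction h using Relation.ReflTransGen.head_induction_on generalizing r with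
  | refl => exact (Nat.le_add_right _ _).trans (hr v)
  | head hstep _ ih =>
    obtain ⟨r', hr', hv⟩ := hr.step hT hstep
    exact hv ▸ ih hr'

theorem IsLoadBound.mono {v : V} {D D' r : V → ℕ} (hr : IsLoadBound T v D r)
    (h : ∀ u, D' u ≤ D u) : IsLoadBound T v D' r :=
  fun u => (Nat.add_le_add_right (h u) _).trans (hr u)

/-- The number of pebbles gathered at a vertex `u` at distance `n` from the root in an extremal
distribution with `k` pebbles gathered at the root. -/
noncomputable def extremalLoad (T : SimpleGraph V) (v : V) (k : ℕ) : ℕ → V → ℕ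
  | 0, _ => k
  | n + 1, u => if heavyChild T v (parent T v u) = u
      then 2 * extremalLoad T v k n (parent T v u) + 1 else 1

theorem exists_load (hT : T.IsTree) (v : V) (k : ℕ) :
    ∃ r : V → ℕ, r v = k ∧ ∀ u, u ≠ v → r u =
      if heavyChild T v (parent T v u) = u then 2 * r (parent T v u) + 1 else 1 := by
  refine ⟨fun u => extremalLoad T v k (T.dist v u) u, by simp [extremalLoad], fun u hu => ?_⟩
  simp only
  rw [← (parent_spec hT hu).2, extremalLoad]

theorem exists_extremal (hT : T.IsTree) (v : V) (k : ℕ) :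
    ∃ D r : V → ℕ, IsLoadBound T v D r ∧ r v = k ∧
      ∑ u, D u = k * 2 ^ height T v v + ∑ u with u ≠ v, 2 ^ height T v u := by
  obtain ⟨r, hrv, hr⟩ := exists_load hT v k
  have heq : ∀ u, (if height T v u = 0 then r u else 0) +
      ∑ c with c ≠ v ∧ parent T v c = u, r c / 2 = r u := by
    intro u
    split_ifs with h0
    · rw [sum_eq_zero, add_zero]
      intro c hc
      simp only [mem_filter, mem_univ, true_and] at hc
      have := height_lt_height_parent hT hc.1
      rw [hc.2] at this
      omega
    · obtain ⟨h1, h2, h3⟩ := heavyChild_spec hT (Nat.pos_of_ne_zero h0)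
      rw [sum_eq_single (heavyChild T v u), hr _ h1, h2, if_pos rfl]
      · omega
      · intro c hc hne
        simp only [mem_filter, mem_univ, true_and] at hc
        rw [hr c hc.1, hc.2, if_neg hne.symm, Nat.div_eq_of_lt one_lt_two]
      · intro h
        simp [h1, h2] at h
  refine ⟨_, r, fun u => (heq u).le, hrv, ?_⟩
  have hD : ∑ u, (if height T v u = 0 then r u else 0)
      = ∑ u, 2 ^ height T v u * (if height T v u = 0 then r u else 0) := by
    refine sum_congr rfl fun u _ => ?_
    split_ifs with h <;> simp [h]
  have hfib : ∑ u, 2 ^ height T v u * ∑ c with c ≠ v ∧ parent T v c = u, r c / 2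
      = ∑ c with c ≠ v, 2 ^ height T v (parent T v c) * (r c / 2) := by
    rw [← sum_fiberwise ({c | c ≠ v} : Finset V) (parent T v)]
    refine sum_congr rfl fun u _ => ?_
    rw [mul_sum, filter_filter]
    refine sum_congr rfl fun c hc => ?_
    rw [(mem_filter.1 hc).2.2]
  have hstep : ∀ c, c ≠ v → 2 ^ height T v c * r c
      = 2 ^ height T v (parent T v c) * (r c / 2) + 2 ^ height T v c := by
    intro c hc
    have hrc := hr c hc
    split_ifs at hrc with h
    · obtain ⟨-, -, h3⟩ := heavyChild_spec (v := v) (u := parent T v c) hT (by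
        have := height_lt_height_parent hT hc
        omega)
      rw [h] at h3
      have : r c / 2 = r (parent T v c) := by omega
      rw [this, hrc, ← h3]
      ring
    · simp [hrc]
  have htot : ∑ u, 2 ^ height T v u * r u
      = k * 2 ^ height T v v + ∑ c with c ≠ v, 2 ^ height T v c * r c := by
    rw [filter_ne', ← add_sum_erase _ _ (mem_univ v), hrv, mul_comm]
  have hlin : ∑ u, 2 ^ height T v u * r u
      = ∑ u, 2 ^ height T v u * (if height T v u = 0 then r u else 0)
        + ∑ c with c ≠ v, 2 ^ height T v (parent T v c) * (r c / 2) := by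
    rw [← hfib, ← sum_add_distrib]
    refine sum_congr rfl fun u _ => ?_
    rw [← mul_add, heq]
  have hsplit : ∑ c with c ≠ v, 2 ^ height T v c * r c
      = ∑ c with c ≠ v, 2 ^ height T v (parent T v c) * (r c / 2)
        + ∑ c with c ≠ v, 2 ^ height T v c := by
    rw [← sum_add_distrib]
    exact sum_congr rfl fun c hc => hstep c (mem_filter.1 hc).2
  omega

theorem exists_le_sum_eq (D : V → ℕ) {N : ℕ} (h : N ≤ ∑ u, D u) :
    ∃ D' : V → ℕ, (∀ u, D' u ≤ D u) ∧ ∑ u, D' u = N := by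
  induction h using Nat.decreasingInduction with
  | self => exact ⟨D, fun _ => le_rfl, rfl⟩
  | of_succ n _ ih =>
    obtain ⟨D', hle, hsum⟩ := ih
    obtain ⟨w, -, hw⟩ : ∃ w ∈ univ, D' w ≠ 0 := exists_ne_zero_of_sum_ne_zero (by omega)
    refine ⟨Function.update D' w (D' w - 1), fun u => ?_, ?_⟩
    · by_cases hu : u = w
      · subst hu
        have := hle u
        simp only [Function.update_self]
        omega
      · simpa [hu] using hle u
    · rw [sum_update_of_mem (mem_univ w), sdiff_singleton_eq_erase]
      have := add_sum_erase univ D' (mem_univ w)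
      omega

theorem exists_reach_weight_le (hT : T.IsTree) (v : V) (D : V → ℕ) :
    ∃ D', PebReach T D D' ∧ ∑ u, 2 ^ height T v u * D u
      ≤ D' v * 2 ^ height T v v + ∑ u with u ≠ v, 2 ^ height T v u := by
  induction hn : ∑ u, D u using Nat.strong_induction_on generalizing D with
  | _ n ih =>
  by_cases hterm : ∀ u, u ≠ v → D u ≤ 1
  · refine ⟨D, Relation.ReflTransGen.refl, ?_⟩
    rw [filter_ne', ← add_sum_erase _ _ (mem_univ v), mul_comm]
    gcongr with u hu
    simpa using Nat.mul_le_mul_left (2 ^ height T v u) (hterm u (ne_of_mem_erase hu))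
  push Not at hterm
  obtain ⟨a, hav, ha⟩ := hterm
  obtain ⟨hadj, -⟩ := parent_spec hT hav
  set b := parent T v a with hb
  have hba : b ≠ a := hadj.ne'
  have hh := height_lt_height_parent hT hav
  set E : V → ℕ := fun x => if x = a then D a - 2 else if x = b then D b + 1 else D x with hE
  have hstep : PebStep T D E := ⟨a, b, hadj, ha, rfl⟩
  have hsplit : ∀ (f : V → ℕ), ∑ u, f u = f a + (f b + ∑ u ∈ (univ.erase a).erase b, f u) := by
    intro f
    rw [← add_sum_erase _ _ (mem_univ a),
      ← add_sum_erase (univ.erase a) _ (mem_erase.2 ⟨hba, mem_univ b⟩)]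
  have hEa : E a = D a - 2 := by simp [hE]
  have hEb : E b = D b + 1 := by simp [hE, hba]
  have hEu : ∀ u ∈ (univ.erase a).erase b, E u = D u := by
    intro u hu
    simp only [mem_erase, mem_univ, and_true] at hu
    simp [hE, hu.1, hu.2]
  obtain ⟨D', hreach, hw⟩ := ih (∑ u, E u) (by
    have : ∑ u ∈ (univ.erase a).erase b, E u = ∑ u ∈ (univ.erase a).erase b, D u :=
      sum_congr rfl hEu
    rw [← hn, hsplit E, hsplit D, hEa, hEb]
    omega) E rfl
  refine ⟨D', Relation.ReflTransGen.head hstep hreach, le_trans ?_ hw⟩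
  have hsum : ∑ u ∈ (univ.erase a).erase b, 2 ^ height T v u * E u
      = ∑ u ∈ (univ.erase a).erase b, 2 ^ height T v u * D u :=
    sum_congr rfl fun u hu => by rw [hEu u hu]
  rw [hsplit, hsplit (fun u => 2 ^ height T v u * E u), hEa, hEb, hsum]
  have hpow : 2 ^ height T v a * 2 ≤ 2 ^ height T v b := by
    rw [← pow_succ]
    exact Nat.pow_le_pow_right two_pos hh
  obtain ⟨m, hm⟩ : ∃ m, D a = m + 2 := Nat.exists_eq_add_of_le' ha
  rw [hm, Nat.add_sub_cancel]
  nlinarith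

theorem ftNum_eq (hT : T.IsTree) (v : V) {t : ℕ} (ht : 1 ≤ t) :
    ftNum T v t = (t - 1) * 2 ^ height T v v + ∑ u with u ≠ v, 2 ^ height T v u + 1 := by
  refine IsLeast.csInf_eq ⟨fun D hD => ?_, fun N hN => ?_⟩
  · obtain ⟨D', hreach, hw⟩ := exists_reach_weight_le hT v D
    refine ⟨D', hreach, ?_⟩
    have hle : ∑ u, D u ≤ ∑ u, 2 ^ height T v u * D u :=
      sum_le_sum fun u _ => Nat.le_mul_of_pos_left _ (by positivity)
    by_contra! hlt
    have : D' v * 2 ^ height T v v ≤ (t - 1) * 2 ^ height T v v :=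
      Nat.mul_le_mul_right _ (by omega)
    omega
  · by_contra! hlt
    obtain ⟨D, r, hr, hrv, hsum⟩ := exists_extremal hT v (t - 1)
    obtain ⟨D', hle, hD'⟩ := exists_le_sum_eq D (N := N) (by omega)
    obtain ⟨E, hE, htE⟩ := hN D' hD'
    have := (hr.mono hle).apply_root_le hT hE
    omega

end Pebbling

section Partition

variable {T : SimpleGraph U} {v : U}

theorem isPath_of_parent_darts (hT : T.IsTree) {a b : U} (w : T.Walk a b)
    (hw : ∀ d ∈ w.darts, d.fst ≠ v ∧ parent T v d.fst = d.snd) :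
    w.IsPath ∧ ∀ u ∈ w.support, T.dist v u ≤ T.dist v a := by
  induction w with
  | nil => simp
  | cons hadj p ih =>
    rename_i a c b
    simp only [Walk.darts_cons, List.mem_cons, forall_eq_or_imp] at hw
    obtain ⟨hp, hle⟩ := ih hw.2
    have hlt := (parent_spec hT hw.1.1).2
    rw [hw.1.2] at hlt
    refine ⟨(Walk.cons_isPath_iff _ _).2 ⟨hp, fun ha => ?_⟩, ?_⟩
    · have := hle a ha
      omega
    · simp only [Walk.support_cons, List.mem_cons, forall_eq_or_imp, le_refl, true_and]
      intro u hu
      have := hle u hu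
      omega

theorem eq_of_not_lex_of_sum_tsub_le {L M : List ℕ} (hL : L.SortedGE) (hM : M.SortedGE)
    (hpos : ∀ a ∈ L, 0 < a)
    (hle : ∀ y, (L.map (· - y)).sum ≤ (M.map (· - y)).sum)
    (hlex : ¬ List.Lex (· < ·) L M) : L = M := by
  induction L generalizing M with
  | nil =>
    cases M with
    | nil => rfl
    | cons m M => exact absurd List.Lex.nil hlex
  | cons l L ih =>
    cases M with
    | nil =>
      have h1 := hle 0
      have h2 := hpos l List.mem_cons_self
      simp at h1
      omega
    | cons m M =>
      rw [List.sortedGE_iff_pairwise, List.pairwise_cons] at hL hM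
      have hml : m ≤ l := not_lt.1 fun h => hlex (List.Lex.rel h)
      have hlm : l ≤ m := by
        have h1 := hle m
        have h2 : (M.map (· - m)).sum = 0 := by
          refine List.sum_eq_zero fun x hx => ?_
          obtain ⟨a, ha, rfl⟩ := List.mem_map.1 hx
          have := hM.1 a ha
          omega
        simp only [List.map_cons, List.sum_cons, h2] at h1
        omega
      obtain rfl : l = m := le_antisymm hlm hml
      congr 1
      refine ih hL.2.sortedGE hM.2.sortedGE (fun a ha => hpos a (List.mem_cons_of_mem _ ha))
        (fun y => ?_) fun h => hlex (List.Lex.cons h)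
      simpa using hle y

theorem sum_range_ite_le (y a : ℕ) : ∑ i ∈ range a, (if y ≤ i then 1 else 0) = a - y := by
  induction a with
  | zero => simp
  | succ a ih =>
    rw [sum_range_succ, ih]
    split_ifs <;> omega

/-- The vertices at which the edges of a directed path start. -/
def sources {a b : U} (w : T.Walk a b) : List U := w.darts.map (·.fst)

/-- The potential `φ` orients exactly the edges from a vertex outside `A` to its parent. -/
def OrientsOutside (T : SimpleGraph U) (v : U) (A : Finset U) (φ : U → ℕ) : Prop :=
  ∀ a b, T.Adj a b → (φ b < φ a ↔ a ∉ A ∧ parent T v a = b)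

theorem parent_darts_of_orientsOutside {A : Finset U} {φ : U → ℕ} (hvA : v ∈ A)
    (hφ : OrientsOutside T v A φ) {a b : U} {w : T.Walk a b}
    (hw : ∀ d ∈ w.darts, φ d.snd < φ d.fst) :
    ∀ d ∈ w.darts, d.fst ≠ v ∧ parent T v d.fst = d.snd := by
  intro d hd
  obtain ⟨h1, h2⟩ := (hφ _ _ d.adj).1 (hw d hd)
  exact ⟨fun h => h1 (h ▸ hvA), h2⟩

theorem mem_sources_iff_of_orientsOutside {A : Finset U} {φ : U → ℕ}
    (hφ : OrientsOutside T v A φ) {a b : U} {w : T.Walk a b}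
    (hw : ∀ d ∈ w.darts, φ d.snd < φ d.fst) {c : U} :
    c ∈ sources w ↔ c ∉ A ∧ s(c, parent T v c) ∈ w.edges := by
  constructor
  · intro hc
    obtain ⟨d, hd, rfl⟩ := List.mem_map.1 hc
    obtain ⟨h1, h2⟩ := (hφ _ _ d.adj).1 (hw d hd)
    exact ⟨h1, List.mem_map.2 ⟨d, hd, by rw [h2]; rfl⟩⟩
  · rintro ⟨hc, he⟩
    obtain ⟨d, hd, hde⟩ := List.mem_map.1 he
    have hlt := hw d hd
    rcases (dart_edge_eq_mk'_iff' (d := d)).1 hde with ⟨h1, -⟩ | ⟨h1, h2⟩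
    · exact List.mem_map.2 ⟨d, hd, h1⟩
    · have h3 := (hφ _ _ d.adj.symm).2 ⟨h2 ▸ hc, by rw [h1, h2]⟩
      omega

theorem pathsExtra_eq_sum_range (P : PathSys T) :
    pathsExtra P = ((sysLengths P).map fun a => ∑ i ∈ range a, 2 ^ i).sum := by
  simp only [pathsExtra, Nat.geomSum_eq (le_refl 2), Nat.div_one, Nat.reduceSub]

variable [Fintype U]

theorem sum_range_le_sum_sources (hT : T.IsTree) {f : ℕ → ℕ} (hf : Monotone f) {a b : U}
    (w : T.Walk a b) (hw : ∀ d ∈ w.darts, d.fst ≠ v ∧ parent T v d.fst = d.snd) (k : ℕ)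
    (hk : k ≤ height T v a) :
    ∑ i ∈ range w.length, f (k + i) ≤ ((sources w).map fun c => f (height T v c)).sum := by
  induction w generalizing k with
  | nil => simp
  | cons hadj p ih =>
    simp only [Walk.darts_cons, List.mem_cons, forall_eq_or_imp] at hw
    have hlt := height_lt_height_parent hT hw.1.1
    rw [hw.1.2] at hlt
    have := ih hw.2 (k + 1) (by omega)
    rw [Walk.length_cons, sum_range_succ']
    simp only [sources, Walk.darts_cons, List.map_cons, List.sum_cons] at this ⊢
    rw [add_comm, add_zero]
    refine add_le_add (hf hk) (le_trans (le_of_eq ?_) this)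
    exact sum_congr rfl fun i _ => by rw [add_right_comm, add_assoc]

theorem exists_heavyPath (hT : T.IsTree) {A : Finset U} (hvA : v ∈ A) (n : ℕ) (c : U)
    (hn : T.dist v c ≤ n) (hc : c ∉ A) :
    ∃ (b : U) (w : T.Walk c b), c ∈ sources w ∧
      (∀ d ∈ w.darts, d.fst ∉ A ∧ parent T v d.fst = d.snd) ∧
      (∀ d ∈ sources w, d = c ∨ (0 < height T v d ∧ heavyChild T v d ∈ sources w)) ∧
      (∀ e ∈ sources w, parent T v e ∉ A → heavyChild T v (parent T v e) = e →
        parent T v e ∈ sources w) ∧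
      ∀ (f : ℕ → ℕ), ∑ i ∈ range w.length, f (height T v c + i) =
        ((sources w).map fun c => f (height T v c)).sum := by
  have hcv : c ≠ v := fun h => hc (h ▸ hvA)
  induction n generalizing c with
  | zero =>
    have := hT.connected.pos_dist_of_ne hcv.symm
    omega
  | succ n ih =>
  obtain ⟨hadj, hdist⟩ := parent_spec hT hcv
  have hlt := height_lt_height_parent hT hcv
  by_cases h : parent T v c ∉ A ∧ heavyChild T v (parent T v c) = c
  · obtain ⟨hp, hheavy⟩ := h
    obtain ⟨b, w, hmem, hdart, hdown, hup, hsum⟩ := ih _ (by omega) hp fun h => hp (h.symm ▸ hvA)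
    have hsrc : sources (Walk.cons hadj w) = c :: sources w := rfl
    refine ⟨b, Walk.cons hadj w, by simp [hsrc], ?_, ?_, ?_, fun f => ?_⟩
    · simpa [hc] using hdart
    · intro d hd
      rw [hsrc, List.mem_cons] at hd
      rw [hsrc]
      rcases hd with rfl | hd
      · exact Or.inl rfl
      · right
        rw [List.mem_cons]
        rcases hdown d hd with rfl | ⟨h1, h2⟩
        · exact ⟨by omega, Or.inl hheavy⟩
        · exact ⟨h1, Or.inr h2⟩
    · intro e he hA hchild
      rw [hsrc, List.mem_cons] at he ⊢
      rcases he with rfl | he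
      · exact Or.inr hmem
      · exact Or.inr (hup e he hA hchild)
    · have hh := (heavyChild_spec (v := v) (u := parent T v c) hT (by omega)).2.2
      rw [hheavy] at hh
      rw [Walk.length_cons, sum_range_succ', hsrc, List.map_cons, List.sum_cons, ← hsum, ← hh,
        add_comm, add_zero]
      congr 1
      exact sum_congr rfl fun i _ => by rw [add_right_comm, add_assoc]
  · have hsrc : sources hadj.toWalk = [c] := rfl
    refine ⟨_, hadj.toWalk, by simp [hsrc], ?_, ?_, ?_, fun f => by simp [hsrc]⟩
    · simp [hc]
    · simp [hsrc]
    · simp only [hsrc, List.mem_singleton, forall_eq]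
      exact fun h1 h2 => absurd ⟨h1, h2⟩ h

variable [DecidableEq U]

theorem sum_sources_eq {A : Finset U} {φ : U → ℕ} {P : PathSys T} (hT : T.IsTree)
    (hvA : v ∈ A) (hφ : OrientsOutside T v A φ) (hP : IsPartitionTo T φ P) (f : U → ℕ) :
    (P.map fun q => ((sources q.2.2).map f).sum).sum = ∑ c with c ∉ A, f c := by
  obtain ⟨hpath, hdisj, hcov⟩ := hP
  have hnodup : (P.flatMap fun q => sources q.2.2).Nodup := by
    rw [List.nodup_flatMap]
    constructor
    · intro q hq
      rw [sources, Walk.map_fst_darts]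
      exact (List.dropLast_sublist _).nodup (hpath q hq).1.support_nodup
    · refine hdisj.imp_of_mem fun {q r} hq hr hqr => ?_
      rw [Function.onFun, List.disjoint_left]
      intro c hcq hcr
      exact hqr _ ((mem_sources_iff_of_orientsOutside hφ (hpath q hq).2.2).1 hcq).2
        ((mem_sources_iff_of_orientsOutside hφ (hpath r hr).2.2).1 hcr).2
  have hmem : (P.flatMap fun q => sources q.2.2).toFinset = ({c | c ∉ A} : Finset U) := by
    ext c
    simp only [List.mem_toFinset, List.mem_flatMap, mem_filter, mem_univ, true_and]
    constructor
    · rintro ⟨q, hq, hc⟩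
      exact ((mem_sources_iff_of_orientsOutside hφ (hpath q hq).2.2).1 hc).1
    · intro hc
      have hadj := (parent_spec hT (v := v) (u := c) fun h => hc (h ▸ hvA)).1
      obtain ⟨q, hq, he⟩ := hcov _ _ hadj ((hφ _ _ hadj).2 ⟨hc, rfl⟩)
      exact ⟨q, hq, (mem_sources_iff_of_orientsOutside hφ (hpath q hq).2.2).2 ⟨hc, he⟩⟩
  rw [← hmem, List.sum_toFinset _ hnodup, List.map_flatMap, List.flatMap, List.sum_flatten,
    List.map_map]
  rfl

theorem sum_sysLengths_le {A : Finset U} {φ : U → ℕ} {P : PathSys T} (hT : T.IsTree)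
    (hvA : v ∈ A) (hφ : OrientsOutside T v A φ) (hP : IsPartitionTo T φ P) {f : ℕ → ℕ}
    (hf : Monotone f) :
    ((sysLengths P).map fun a => ∑ i ∈ range a, f i).sum ≤ ∑ c with c ∉ A, f (height T v c) := by
  rw [← sum_sources_eq hT hvA hφ hP, sysLengths, List.map_map]
  refine List.sum_le_sum fun q hq => ?_
  simpa using sum_range_le_sum_sources hT hf q.2.2
    (parent_darts_of_orientsOutside hvA hφ (hP.1 q hq).2.2) 0 (Nat.zero_le _)

theorem exists_heavyPartition (hT : T.IsTree) {A : Finset U} {φ : U → ℕ} (hvA : v ∈ A)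
    (hA : ∀ c ∈ A, c ≠ v → parent T v c ∈ A) (hφ : OrientsOutside T v A φ) :
    ∃ Q : PathSys T, IsPartitionTo T φ Q ∧ ∀ f : ℕ → ℕ,
      ((sysLengths Q).map fun a => ∑ i ∈ range a, f i).sum = ∑ c with c ∉ A, f (height T v c) := by
  have hex := fun c : {c // c ∉ A} => exists_heavyPath hT hvA _ c.1 le_rfl c.2
  choose b w hmem hdart hdown hup hsum using hex
  set leaves : List {c // c ∉ A} :=
    ({c | height T v c.1 = 0} : Finset {c // c ∉ A}).toList with hleaves
  have hleaf : ∀ c, c ∈ leaves ↔ height T v c.1 = 0 := by simp [hleaves]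
  set Q : PathSys T := leaves.map fun c => ⟨c.1, b c, w c⟩ with hQ
  have hφw : ∀ c, ∀ d ∈ (w c).darts, φ d.snd < φ d.fst :=
    fun c d hd => (hφ _ _ d.adj).2 (hdart c d hd)
  have huniq : ∀ n, ∀ l ∈ leaves, ∀ l' ∈ leaves, ∀ d, height T v d = n → d ∈ sources (w l) →
      d ∈ sources (w l') → l = l' := by
    intro n
    induction n using Nat.strong_induction_on with
    | _ n ih =>
    intro l hl l' hl' d hd h1 h2
    rw [hleaf] at hl hl'
    rcases hdown l d h1 with h3 | ⟨h3, h4⟩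
    · rcases hdown l' d h2 with h5 | ⟨h5, -⟩
      · exact Subtype.ext (h3.symm.trans h5)
      · rw [h3] at h5
        omega
    · rcases hdown l' d h2 with h5 | ⟨-, h6⟩
      · rw [h5] at h3
        omega
      · have := (heavyChild_spec hT h3).2.2
        exact ih _ (by omega) l ((hleaf l).2 hl) l' ((hleaf l').2 hl') _ rfl h4 h6
  have hcov : ∀ n, ∀ d, height T v d = n → d ∉ A → ∃ l ∈ leaves, d ∈ sources (w l) := by
    intro n
    induction n with
    | zero => exact fun d hd hdA => ⟨⟨d, hdA⟩, (hleaf _).2 hd, hmem _⟩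
    | succ n ih =>
      intro d hd hdA
      obtain ⟨h1, h2, h3⟩ := heavyChild_spec (v := v) (u := d) hT (by omega)
      have h4 : heavyChild T v d ∉ A := fun h => hdA (h2 ▸ hA _ h h1)
      obtain ⟨l, hl, hmeml⟩ := ih (heavyChild T v d) (by omega) h4
      refine ⟨l, hl, ?_⟩
      have := hup l _ hmeml
      rw [h2] at this
      exact this hdA rfl
  have hpart : IsPartitionTo T φ Q := by
    refine ⟨?_, ?_, ?_⟩
    · intro q hq
      obtain ⟨l, hl, rfl⟩ := List.mem_map.1 hq
      refine ⟨(isPath_of_parent_darts hT (w l)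
        (parent_darts_of_orientsOutside hvA hφ (hφw l))).1, ?_, hφw l⟩
      have := List.length_pos_of_mem (hmem l)
      simpa [sources] using this
    · rw [hQ, List.pairwise_map]
      refine List.Pairwise.imp_of_mem ?_ (Finset.nodup_toList _)
      intro l l' hl hl' hne e he he'
      apply hne
      obtain ⟨d, hd, hde⟩ := List.mem_map.1 he
      have hds : d.fst ∈ sources (w l) := List.mem_map_of_mem hd
      refine huniq _ l hl l' hl' d.fst rfl hds ?_
      rw [mem_sources_iff_of_orientsOutside hφ (hφw l')]
      refine ⟨(hdart l d hd).1, ?_⟩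
      rw [(hdart l d hd).2]
      rwa [← hde] at he'
    · intro a c hadj hlt
      obtain ⟨ha, rfl⟩ := (hφ _ _ hadj).1 hlt
      obtain ⟨l, hl, hmeml⟩ := hcov _ a rfl ha
      exact ⟨_, List.mem_map_of_mem hl,
        ((mem_sources_iff_of_orientsOutside hφ (hφw l)).1 hmeml).2⟩
  refine ⟨Q, hpart, fun f => ?_⟩
  rw [← sum_sources_eq hT hvA hφ hpart, sysLengths, List.map_map]
  congr 1
  refine List.map_congr_left fun q hq => ?_
  obtain ⟨l, hl, rfl⟩ := List.mem_map.1 hq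
  have := hsum l f
  rw [(hleaf l).1 hl] at this
  simpa using this

theorem pathsExtra_eq (hT : T.IsTree) {A : Finset U} {φ : U → ℕ} (hvA : v ∈ A)
    (hA : ∀ c ∈ A, c ≠ v → parent T v c ∈ A) (hφ : OrientsOutside T v A φ) {P : PathSys T}
    (hP : IsMaxPartitionTo T φ P) : pathsExtra P = ∑ c with c ∉ A, 2 ^ height T v c := by
  obtain ⟨Q, hQ, hQsum⟩ := exists_heavyPartition hT hvA hA hφ
  have hperm : ∀ l, (sortDesc l).Perm l := List.perm_insertionSort _
  have heq : sortDesc (sysLengths P) = sortDesc (sysLengths Q) := by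
    refine eq_of_not_lex_of_sum_tsub_le List.sortedGE_insertionSort
      List.sortedGE_insertionSort ?_ (fun y => ?_) (hP.2 Q hQ)
    · intro a ha
      obtain ⟨q, hq, rfl⟩ := List.mem_map.1 ((hperm _).mem_iff.1 ha)
      exact (hP.1.1 q hq).2.1
    · rw [((hperm _).map _).sum_eq, ((hperm (sysLengths Q)).map _).sum_eq]
      have hmono : Monotone fun i => if y ≤ i then 1 else 0 := by
        intro i j hij
        dsimp only
        split_ifs <;> omega
      have h1 := (sum_sysLengths_le hT hvA hφ hP.1 hmono).trans_eq
        (hQsum fun i => if y ≤ i then 1 else 0).symm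
      simpa only [sum_range_ite_le] using h1
  rw [pathsExtra_eq_sum_range, ← hQsum, ← ((hperm (sysLengths P)).map _).sum_eq, heq,
    ((hperm (sysLengths Q)).map _).sum_eq]

end Partition

section RootPath

variable {T : SimpleGraph U} {v : U}

theorem orientsOutside_distToSet (hT : T.IsTree) {A : Finset U} (hvA : v ∈ A)
    (hA : ∀ c ∈ A, c ≠ v → parent T v c ∈ A) : OrientsOutside T v A (distToSet T A) := by
  have hmem : ∀ c ∈ A, distToSet T A c = 0 :=
    fun c hc => Nat.sInf_eq_zero.2 (Or.inl ⟨c, hc, by simp⟩)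
  have hle : ∀ u, ∀ c ∈ A, distToSet T A u ≤ T.dist u c := fun u c hc => Nat.sInf_le ⟨c, hc, rfl⟩
  have hex : ∀ u, ∃ c ∈ A, T.dist u c = distToSet T A u := fun u =>
    Nat.sInf_mem (s := {n | ∃ w ∈ (A : Set U), T.dist u w = n}) ⟨_, v, hvA, rfl⟩
  have hpos : ∀ c, c ∉ A → 0 < distToSet T A c := by
    intro c hc
    obtain ⟨w, hw, hd⟩ := hex c
    rw [← hd]
    exact hT.connected.pos_dist_of_ne fun h => hc (h ▸ hw)
  have hpar : ∀ n, ∀ c, distToSet T A c = n → c ∉ A →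
      distToSet T A (parent T v c) < distToSet T A c := by
    intro n
    induction n with
    | zero => exact fun c h0 hc => absurd (hpos c hc) (by omega)
    | succ n ih =>
      intro c hn hc
      obtain ⟨w, hw, hd⟩ := hex c
      obtain ⟨c', hadj, hc'⟩ := exists_adj_dist_add_one hT.connected (u := c) (w := w)
        fun h => hc (h ▸ hw)
      have h1 := hle c' w hw
      rcases adj_cases hT v hadj with ⟨-, rfl⟩ | ⟨hv, rfl⟩
      · omega
      · have hcA : c' ∉ A := fun h => hc (hA _ h hv)
        have h2 : distToSet T A c' = n := by
          obtain ⟨z, hz, hdz⟩ := hex c'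
          have h3 := hle (parent T v c') z hz
          have h4 := hT.connected.dist_triangle (u := parent T v c') (v := c') (w := z)
          have h5 := dist_eq_one_iff_adj.2 hadj
          omega
        have := ih c' h2 hcA
        omega
  intro a b hadj
  constructor
  · intro hlt
    have ha : a ∉ A := fun h => by
      have := hmem a h
      omega
    rcases adj_cases hT v hadj with ⟨-, h⟩ | ⟨hb, rfl⟩
    · exact ⟨ha, h⟩
    · have := hpar _ b rfl fun h => ha (hA b h hb)
      omega
  · rintro ⟨ha, rfl⟩
    exact hpar _ a rfl ha

variable [Fintype U]

/-- The vertices on the path from the root `v` to `x`. -/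
noncomputable def rootPath (T : SimpleGraph U) (v x : U) : Finset U :=
  {c | T.dist v c + T.dist c x = T.dist v x}

theorem mem_rootPath {x c : U} : c ∈ rootPath T v x ↔ T.dist v c + T.dist c x = T.dist v x := by
  simp [rootPath]

theorem parent_mem_rootPath (hT : T.IsTree) {x c : U} (hc : c ∈ rootPath T v x) (hcv : c ≠ v) :
    parent T v c ∈ rootPath T v x := by
  rw [mem_rootPath] at hc ⊢
  obtain ⟨hadj, hd⟩ := parent_spec hT hcv
  have h1 := hT.connected.dist_triangle (u := parent T v c) (v := c) (w := x)
  have h2 := hT.connected.dist_triangle (u := v) (v := parent T v c) (w := x)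
  have h3 := dist_eq_one_iff_adj.2 hadj.symm
  omega

theorem iterate_parent_eq (hT : T.IsTree) {x c : U} (hc : c ∈ rootPath T v x) :
    (parent T v)^[T.dist c x] x = c := by
  induction hn : T.dist c x generalizing c with
  | zero => exact (hT.connected.dist_eq_zero_iff.1 hn).symm
  | succ n ih =>
    rw [mem_rootPath] at hc
    obtain ⟨c', hadj, hc'⟩ := exists_adj_dist_add_one hT.connected (u := c) (w := x) (by
      rintro rfl
      simp at hn)
    have h1 := hT.connected.dist_triangle (u := v) (v := c') (w := x)
    have h2 := hT.connected.dist_triangle (u := v) (v := c) (w := c')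
    have h3 := dist_eq_one_iff_adj.2 hadj
    rw [Function.iterate_succ_apply', ih (c := c') (mem_rootPath.2 (by omega)) (by omega)]
    exact (eq_parent hT hadj.symm (by omega)).symm

theorem iterate_parent_mem (hT : T.IsTree) {x : U} {i : ℕ} (hi : i ≤ T.dist v x) :
    (parent T v)^[i] x ∈ rootPath T v x ∧ T.dist ((parent T v)^[i] x) x = i := by
  induction i with
  | zero => simp [mem_rootPath]
  | succ i ih =>
    obtain ⟨hmem, hd⟩ := ih (by omega)
    have hmem' := mem_rootPath.1 hmem
    have hne : (parent T v)^[i] x ≠ v := by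
      intro h
      rw [h] at hd
      omega
    rw [Function.iterate_succ_apply']
    have hp := parent_mem_rootPath hT hmem hne
    have hp' := mem_rootPath.1 hp
    have := (parent_spec hT hne).2
    exact ⟨hp, by omega⟩

theorem dist_le_height_of_mem_rootPath {x c : U} (hc : c ∈ rootPath T v x) :
    T.dist c x ≤ height T v c :=
  dist_le_height (mem_rootPath.1 hc).symm

theorem height_add_dist_le (T : SimpleGraph U) (v c : U) : height T v c + T.dist v c ≤ height T v v := by
  obtain ⟨w, hw, hw'⟩ := exists_dist_eq_height T v c
  have := dist_le_height (T := T) (v := v) (u := v) (w := w) (by simp)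
  omega

variable [DecidableEq U]

theorem sum_rootPath (hT : T.IsTree) (x : U) (f : ℕ → ℕ) :
    ∑ c ∈ (rootPath T v x).erase v, f (T.dist c x) = ∑ i ∈ range (T.dist v x), f i := by
  refine sum_nbij' (fun c => T.dist c x) (fun i => (parent T v)^[i] x) ?_ ?_ ?_ ?_ fun _ _ => rfl
  · intro c hc
    obtain ⟨hcv, hc⟩ := mem_erase.1 hc
    have := mem_rootPath.1 hc
    have := hT.connected.pos_dist_of_ne hcv.symm
    rw [mem_range]
    omega
  · intro i hi
    rw [mem_range] at hi
    obtain ⟨h1, h2⟩ := iterate_parent_mem hT hi.le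
    refine mem_erase.2 ⟨fun h => ?_, h1⟩
    rw [h] at h2
    omega
  · exact fun c hc => iterate_parent_eq hT (mem_of_mem_erase hc)
  · exact fun i hi => (iterate_parent_mem hT (mem_range.1 hi).le).2

theorem sum_ne_root (T : SimpleGraph U) (v x : U) (f : U → ℕ) :
    ∑ c with c ≠ v, f c
      = ∑ c ∈ (rootPath T v x).erase v, f c + ∑ c with c ∉ rootPath T v x, f c := by
  rw [← sum_filter_add_sum_filter_not _ (· ∈ rootPath T v x), filter_filter, filter_filter]
  congr 1
  · refine sum_congr ?_ fun _ _ => rfl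
    ext c
    simp
  · refine sum_congr ?_ fun _ _ => rfl
    ext c
    simp only [mem_filter, mem_univ, true_and, and_iff_right_iff_imp]
    rintro h rfl
    simp [mem_rootPath] at h

theorem phiOmega_eq (hT : T.IsTree) {t : ℕ} (ht : 1 ≤ t) (x : U) :
    phiOmega T (fun u => if u = v then t else 0) x = distToSet T (rootPath T v x) := by
  rw [phiOmega]
  congr 1
  have hset : {u | 0 < if u = v then t else 0} = {v} := by
    ext u
    by_cases h : u = v <;> simp [h]
    omega
  ext c
  rw [hset, mem_coe, mem_rootPath]
  simp only [subtreeSpan, Set.mem_insert_iff, Set.mem_singleton_iff, Set.mem_ofPred_eq,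
    exists_eq_or_imp, exists_eq_left, SimpleGraph.dist_self, Nat.add_eq_zero_iff,
    hT.connected.dist_eq_zero_iff]
  constructor
  · rintro ((⟨rfl, -⟩ | h) | h | ⟨rfl, -⟩)
    · simp
    · rw [T.dist_comm (u := v), T.dist_comm (v := x), T.dist_comm (u := v)]
      omega
    · exact h
    · simp
  · exact fun h => Or.inr (Or.inl h)

end RootPath

end TreePebbling

open TreePebbling

/-- When `ω` is supported on the single vertex `v` with weight `t ≥ 1`,
`f_t(T, v) = s_ω(T) = max_x [ t·2^{d(v,x)} + Σᵢ (2^{aᵢ} - 1) ]`. -/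
theorem t_pebbling_eq_s_omega (T : SimpleGraph V) [Fintype V] (hT : T.IsTree)
    (v : V) (t : ℕ) (ht : 1 ≤ t) (s : V → ℕ)
    (hs : ∀ x : V, ∃ P : PathSys T,
      IsMaxPartitionTo T (phiOmega T (fun u => if u = v then t else 0) x) P ∧
      s x = t * 2 ^ T.dist v x + pathsExtra P) :
    ftNum T v t = Finset.univ.sup s := by
  have hpow : ∀ n, ∑ i ∈ range n, 2 ^ i + 1 = 2 ^ n := fun n => by
    induction n with
    | zero => simp
    | succ n ih =>
      rw [sum_range_succ, pow_succ]
      omega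
  have hs' : ∀ x, s x = t * 2 ^ T.dist v x +
      ∑ c with c ∉ rootPath T v x, 2 ^ height T v c := by
    intro x
    obtain ⟨P, hP, hsx⟩ := hs x
    rw [phiOmega_eq hT ht] at hP
    have hv : v ∈ rootPath T v x := by simp [mem_rootPath]
    have hA : ∀ c ∈ rootPath T v x, c ≠ v → parent T v c ∈ rootPath T v x :=
      fun c hc => parent_mem_rootPath hT hc
    rw [hsx, pathsExtra_eq hT hv hA (orientsOutside_distToSet hT hv hA) hP]
  obtain ⟨k, rfl⟩ : ∃ k, t = k + 1 := Nat.exists_eq_add_of_le' ht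
  rw [ftNum_eq hT v ht, Nat.add_sub_cancel]
  refine le_antisymm ?_ (Finset.sup_le fun x _ => ?_)
  · obtain ⟨x, -, hx⟩ := exists_dist_eq_height T v v
    refine le_trans (le_of_eq ?_) (Finset.le_sup (mem_univ x))
    rw [hs', sum_ne_root T v x, ← hpow (T.dist v x), ← sum_rootPath hT x]
    have hsum : ∑ c ∈ (rootPath T v x).erase v, 2 ^ height T v c
        = ∑ c ∈ (rootPath T v x).erase v, 2 ^ T.dist c x := by
      refine sum_congr rfl fun c hc => ?_
      have h1 := dist_le_height_of_mem_rootPath (mem_of_mem_erase hc)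
      have h2 := mem_rootPath.1 (mem_of_mem_erase hc)
      have h3 := height_add_dist_le T v c
      congr 1
      omega
    rw [hsum, sum_rootPath hT, hpow, ← hx]
    have := hpow (T.dist v x)
    rw [add_one_mul]
    omega
  · rw [hs', sum_ne_root T v x]
    have hle : ∑ c ∈ (rootPath T v x).erase v, 2 ^ T.dist c x
        ≤ ∑ c ∈ (rootPath T v x).erase v, 2 ^ height T v c :=
      sum_le_sum fun c hc => Nat.pow_le_pow_right two_pos
        (dist_le_height_of_mem_rootPath (mem_of_mem_erase hc))
    rw [sum_rootPath hT] at hle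
    have h1 := hpow (T.dist v x)
    have h2 : T.dist v x ≤ height T v v := dist_le_height (by simp)
    have h3 : k * 2 ^ T.dist v x ≤ k * 2 ^ height T v v :=
      Nat.mul_le_mul_left k (Nat.pow_le_pow_right two_pos h2)
    rw [add_one_mul]
    omega
end
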